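/- arXiv:math/9909068 — 2 statements merged into one kernel-verified Lean document; each statement's English description precedes it below -/
import Mathlib

section
/- Lemma 4.6 (reduction by removing a (0,0̄) pair): Let n ≥ 2 and l, k ≥ 3. For b ∈ B_{l−2}, let τ^l_{l−2}(b) ∈ B_l denote the same 2n-tuple regarded as an element of B_l (so x_0 increases by 1); τ^l_{l−2} : B_{l−2} → B_l is injective. Let ι : B_l ⊗ B_k → B_k ⊗ B_l and ι' : B_{l−2} ⊗ B_{k−2} → B_{k−2} ⊗ B_{l−2} be isomorphisms of U_q'(C_n^(1)) crystals, with energy functions H and H' respectively. Then for all b_1 ∈ B_{l−2} and b_2 ∈ B_{k−2}, writing ι'(b_1 ⊗ b_2) = b'_2 ⊗ b'_1, one has ι(τ^l_{l−2}(b_1) ⊗ τ^k_{k−2}(b_2)) = τ^k_{k−2}(b'_2) ⊗ τ^l_{l−2}(b'_1), and H(τ^l_{l−2}(b_1) ⊗ τ^k_{k−2}(b_2)) = H'(b_1 ⊗ b_2). -/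
namespace KTT

/-- Raw data of a crystal element `(x_1,…,x_n,x̄_n,…,x̄_1)`:
`b.1 i` is `x_{i+1}` and `b.2 i` is `x̄_{i+1}` for `i : Fin n`. -/
abbrev Tup (n : ℕ) := (Fin n → ℕ) × (Fin n → ℕ)

/-- The entry `x_j` (for `1 ≤ j ≤ n`). -/
def xc {n : ℕ} (b : Tup n) (j : ℕ) : ℕ :=
  if h : j - 1 < n then b.1 ⟨j - 1, h⟩ else 0

/-- The entry `x̄_j` (for `1 ≤ j ≤ n`). -/
def xbc {n : ℕ} (b : Tup n) (j : ℕ) : ℕ :=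
  if h : j - 1 < n then b.2 ⟨j - 1, h⟩ else 0

/-- Set the entry indexed by `j` (i.e. `x_j`) to the value `v`. -/
def setx {n : ℕ} (f : Fin n → ℕ) (j v : ℕ) : Fin n → ℕ :=
  fun t => if (t : ℕ) + 1 = j then v else f t

/-- `Σ_{i=1}^n (x_i + x̄_i)`. -/
def tsum {n : ℕ} (b : Tup n) : ℕ := ∑ i, (b.1 i + b.2 i)

/-- The element `(v,0,…,0)`. -/
def uvec (n v : ℕ) : Tup n := (fun j => if (j : ℕ) = 0 then v else 0, fun _ => 0)

/-- The element `(0,v,---,0)` (only `x_2 = v` nonzero). -/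
def u2vec (n v : ℕ) : Tup n := (fun j => if (j : ℕ) = 1 then v else 0, fun _ => 0)

/-- The element `(0,0,---,v)` (only `x̄_1 = v` nonzero). -/
def barvec (n v : ℕ) : Tup n := (fun _ => 0, fun j => if (j : ℕ) = 0 then v else 0)

/-- The element `(a,c,---,d)` with `x_1 = a`, `x_2 = c`, `x̄_1 = d`, all else `0`. -/
def tripleVec (n a c d : ℕ) : Tup n :=
  (fun j => if (j : ℕ) = 0 then a else if (j : ℕ) = 1 then c else 0,
   fun j => if (j : ℕ) = 0 then d else 0)

/-! ### The `U_q'(C_n^{(1)})` crystal `B_l` -/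

/-- Membership in the `C_n^{(1)}` crystal `B_l` : the sum of the entries belongs to
`{l, l-2, l-4, …}`. -/
def memC (n l : ℕ) (b : Tup n) : Prop := tsum b ≤ l ∧ (l - tsum b) % 2 = 0

def BC (n l : ℕ) : Set (Tup n) := {b | memC n l b}

/-- The number `x_0(b)` of `(0,0̄)` pairs. -/
def x0 (l : ℕ) {n : ℕ} (b : Tup n) : ℕ := (l - tsum b) / 2

/-- The operator `ẽ_i` on `B_l` (C case); `none` plays the role of `0`. -/
def eC (n l i : ℕ) (b : Tup n) : Option (Tup n) :=
  if i = 0 then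
    if 0 < n then
      if xbc b 1 + 2 ≤ xc b 1 then some (setx b.1 1 (xc b 1 - 2), b.2)
      else if xc b 1 = xbc b 1 + 1 then
        some (setx b.1 1 (xc b 1 - 1), setx b.2 1 (xbc b 1 + 1))
      else if tsum b + 2 ≤ l then some (b.1, setx b.2 1 (xbc b 1 + 2))
      else none
    else none
  else if i = n then
    if 0 < xbc b n then some (setx b.1 n (xc b n + 1), setx b.2 n (xbc b n - 1))
    else none
  else if i < n then
    if xbc b (i + 1) < xc b (i + 1) then
      some (setx (setx b.1 i (xc b i + 1)) (i + 1) (xc b (i + 1) - 1), b.2)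
    else if 0 < xbc b i then
      some (b.1, setx (setx b.2 (i + 1) (xbc b (i + 1) + 1)) i (xbc b i - 1))
    else none
  else none

/-- The operator `f̃_i` on `B_l` (C case). -/
def fC (n l i : ℕ) (b : Tup n) : Option (Tup n) :=
  if i = 0 then
    if 0 < n then
      if xbc b 1 ≤ xc b 1 then
        if tsum b + 2 ≤ l then some (setx b.1 1 (xc b 1 + 2), b.2) else none
      else if xc b 1 + 1 = xbc b 1 then
        some (setx b.1 1 (xc b 1 + 1), setx b.2 1 (xbc b 1 - 1))
      else some (b.1, setx b.2 1 (xbc b 1 - 2))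
    else none
  else if i = n then
    if 0 < xc b n then some (setx b.1 n (xc b n - 1), setx b.2 n (xbc b n + 1))
    else none
  else if i < n then
    if xbc b (i + 1) ≤ xc b (i + 1) then
      if 0 < xc b i then
        some (setx (setx b.1 i (xc b i - 1)) (i + 1) (xc b (i + 1) + 1), b.2)
      else none
    else some (b.1, setx (setx b.2 (i + 1) (xbc b (i + 1) - 1)) i (xbc b i + 1))
  else none

def eCIter (n l i m : ℕ) (b : Tup n) : Option (Tup n) :=
  (fun o => Option.bind o (eC n l i))^[m] (some b)

def fCIter (n l i m : ℕ) (b : Tup n) : Option (Tup n) :=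
  (fun o => Option.bind o (fC n l i))^[m] (some b)

/-- `ε_i(b) = max {m | ẽ_i^m b ≠ 0}` (C case). -/
noncomputable def epsC (n l i : ℕ) (b : Tup n) : ℕ :=
  sSup {m | eCIter n l i m b ≠ none}

/-- `φ_i(b) = max {m | f̃_i^m b ≠ 0}` (C case). -/
noncomputable def phiC (n l i : ℕ) (b : Tup n) : ℕ :=
  sSup {m | fCIter n l i m b ≠ none}

/-- `ẽ_i` on the tensor product `B_l ⊗ B_k` (C case). -/
noncomputable def eTenC (n l k i : ℕ) (u : Tup n × Tup n) : Option (Tup n × Tup n) :=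
  if epsC n k i u.2 ≤ phiC n l i u.1 then (eC n l i u.1).map (fun c => (c, u.2))
  else (eC n k i u.2).map (fun c => (u.1, c))

/-- `f̃_i` on the tensor product `B_l ⊗ B_k` (C case). -/
noncomputable def fTenC (n l k i : ℕ) (u : Tup n × Tup n) : Option (Tup n × Tup n) :=
  if epsC n k i u.2 < phiC n l i u.1 then (fC n l i u.1).map (fun c => (c, u.2))
  else (fC n k i u.2).map (fun c => (u.1, c))

/-- `ι : B_l ⊗ B_k → B_k ⊗ B_l` is an isomorphism of `U_q'(C_n^{(1)})` crystals. -/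
def IsIsoC (n l k : ℕ) (ι : Tup n × Tup n → Tup n × Tup n) : Prop :=
  Set.BijOn ι (BC n l ×ˢ BC n k) (BC n k ×ˢ BC n l) ∧
  ∀ u ∈ BC n l ×ˢ BC n k, ∀ i ≤ n,
    Option.map ι (eTenC n l k i u) = eTenC n k l i (ι u) ∧
    Option.map ι (fTenC n l k i u) = fTenC n k l i (ι u)

/-- `H` is an energy function for the isomorphism `ι` (C case), normalized by
`H((l,0,…,0) ⊗ (0,k,---,0)) = 0`. -/
def IsEnergyC (n l k : ℕ) (ι : Tup n × Tup n → Tup n × Tup n)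
    (H : Tup n × Tup n → ℤ) : Prop :=
  (∀ u ∈ BC n l ×ˢ BC n k, ∀ i ≤ n, ∀ v, eTenC n l k i u = some v →
      H v = H u +
        (if i = 0 then
          (if epsC n k 0 u.2 ≤ phiC n l 0 u.1 ∧ epsC n l 0 (ι u).2 ≤ phiC n k 0 (ι u).1
           then 1
           else if phiC n l 0 u.1 < epsC n k 0 u.2 ∧ phiC n k 0 (ι u).1 < epsC n l 0 (ι u).2
           then -1 else 0)
         else 0)) ∧
  H (uvec n l, u2vec n k) = 0

/-! ### The `U_q'(A_{2n-1}^{(2)})` crystal `B_l` -/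

def memA (n l : ℕ) (b : Tup n) : Prop := tsum b = l

def BA (n l : ℕ) : Set (Tup n) := {b | memA n l b}

/-- The operator `ẽ_i` (A case). -/
def eA (n i : ℕ) (b : Tup n) : Option (Tup n) :=
  if i = 0 then
    if 1 < n then
      if xbc b 2 < xc b 2 then some (setx b.1 2 (xc b 2 - 1), setx b.2 1 (xbc b 1 + 1))
      else if 0 < xc b 1 then some (setx b.1 1 (xc b 1 - 1), setx b.2 2 (xbc b 2 + 1))
      else none
    else none
  else if i = n then
    if 0 < xbc b n then some (setx b.1 n (xc b n + 1), setx b.2 n (xbc b n - 1))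
    else none
  else if i < n then
    if xbc b (i + 1) < xc b (i + 1) then
      some (setx (setx b.1 i (xc b i + 1)) (i + 1) (xc b (i + 1) - 1), b.2)
    else if 0 < xbc b i then
      some (b.1, setx (setx b.2 (i + 1) (xbc b (i + 1) + 1)) i (xbc b i - 1))
    else none
  else none

/-- The operator `f̃_i` (A case). -/
def fA (n i : ℕ) (b : Tup n) : Option (Tup n) :=
  if i = 0 then
    if 1 < n then
      if xbc b 2 ≤ xc b 2 then
        if 0 < xbc b 1 then some (setx b.1 2 (xc b 2 + 1), setx b.2 1 (xbc b 1 - 1))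
        else none
      else some (setx b.1 1 (xc b 1 + 1), setx b.2 2 (xbc b 2 - 1))
    else none
  else if i = n then
    if 0 < xc b n then some (setx b.1 n (xc b n - 1), setx b.2 n (xbc b n + 1))
    else none
  else if i < n then
    if xbc b (i + 1) ≤ xc b (i + 1) then
      if 0 < xc b i then
        some (setx (setx b.1 i (xc b i - 1)) (i + 1) (xc b (i + 1) + 1), b.2)
      else none
    else some (b.1, setx (setx b.2 (i + 1) (xbc b (i + 1) - 1)) i (xbc b i + 1))
  else none

def eAIter (n i m : ℕ) (b : Tup n) : Option (Tup n) :=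
  (fun o => Option.bind o (eA n i))^[m] (some b)

def fAIter (n i m : ℕ) (b : Tup n) : Option (Tup n) :=
  (fun o => Option.bind o (fA n i))^[m] (some b)

noncomputable def epsA (n i : ℕ) (b : Tup n) : ℕ :=
  sSup {m | eAIter n i m b ≠ none}

noncomputable def phiA (n i : ℕ) (b : Tup n) : ℕ :=
  sSup {m | fAIter n i m b ≠ none}

/-- `ẽ_i` on a tensor product (A case). -/
noncomputable def eTenA (n i : ℕ) (u : Tup n × Tup n) : Option (Tup n × Tup n) :=
  if epsA n i u.2 ≤ phiA n i u.1 then (eA n i u.1).map (fun c => (c, u.2))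
  else (eA n i u.2).map (fun c => (u.1, c))

/-- `f̃_i` on a tensor product (A case). -/
noncomputable def fTenA (n i : ℕ) (u : Tup n × Tup n) : Option (Tup n × Tup n) :=
  if epsA n i u.2 < phiA n i u.1 then (fA n i u.1).map (fun c => (c, u.2))
  else (fA n i u.2).map (fun c => (u.1, c))

/-- `ι : B_l ⊗ B_k → B_k ⊗ B_l` is an isomorphism of `U_q'(A_{2n-1}^{(2)})` crystals. -/
def IsIsoA (n l k : ℕ) (ι : Tup n × Tup n → Tup n × Tup n) : Prop :=
  Set.BijOn ι (BA n l ×ˢ BA n k) (BA n k ×ˢ BA n l) ∧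
  ∀ u ∈ BA n l ×ˢ BA n k, ∀ i ≤ n,
    Option.map ι (eTenA n i u) = eTenA n i (ι u) ∧
    Option.map ι (fTenA n i u) = fTenA n i (ι u)

/-- `H` is an energy function for `ι` (A case), normalized by
`H((l,0,…,0) ⊗ (0,0,---,k)) = 0`. -/
def IsEnergyA (n l k : ℕ) (ι : Tup n × Tup n → Tup n × Tup n)
    (H : Tup n × Tup n → ℤ) : Prop :=
  (∀ u ∈ BA n l ×ˢ BA n k, ∀ i ≤ n, ∀ v, eTenA n i u = some v →
      H v = H u +
        (if i = 0 then
          (if epsA n 0 u.2 ≤ phiA n 0 u.1 ∧ epsA n 0 (ι u).2 ≤ phiA n 0 (ι u).1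
           then 1
           else if phiA n 0 u.1 < epsA n 0 u.2 ∧ phiA n 0 (ι u).1 < epsA n 0 (ι u).2
           then -1 else 0)
         else 0)) ∧
  H (uvec n l, barvec n k) = 0

/-! ### Words, tableaux and column insertion

Letters are encoded as natural numbers: the unbarred letter `j` (for `0 ≤ j ≤ n`) is `j`,
and the barred letter `j̄` is `2n+1-j`; the natural order of `ℕ` is the order
`0 < 1 < ⋯ < n < n̄ < ⋯ < 1̄ < 0̄`.  A (two-row) tableau is encoded as the list of its
columns (left to right), each column being the list of its entries (top to bottom). -/

/-- The barred partner `j̄` of an unbarred letter `j`. -/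
def bar (n j : ℕ) : ℕ := 2 * n + 1 - j

/-- Column insertion of a letter into a tableau with at most two rows. -/
def insertLetter (n : ℕ) : ℕ → List (List ℕ) → List (List ℕ)
  | a, [] => [[a]]
  | a, [p] :: rest =>
      if a ≤ p then [a] :: insertLetter n p rest else [p, a] :: rest
  | a, [p, q] :: rest =>
      if p ≠ 0 ∧ p ≤ n ∧ q = bar n p ∧ p ≤ a ∧ a ≤ q then
        -- the column is a pair `(x, x̄)` with `x ≠ 0` and `x ≤ a ≤ x̄`
        [p - 1, a] :: insertLetter n (bar n (p - 1)) rest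
      else if n + 1 ≤ q ∧ bar n q < p ∧ p < q ∧ a = bar n q ∧ q ≠ n + 1 then
        -- the column is `(β, x̄)` with `x < β < x̄`, `a = x` and `x ≠ n`
        [a + 1, bar n (a + 1)] :: insertLetter n p rest
      else if a ≤ p then [a, q] :: insertLetter n p rest
      else if a ≤ q then [p, a] :: insertLetter n q rest
      else [p, q, a] :: rest
  | a, C :: rest => (C ++ [a]) :: rest

/-- Column insertion of a word `u = u_1 ⋯ u_j` into a tableau: `u_j` first, `u_1` last. -/
def insertWord (n : ℕ) (u : List ℕ) (T : List (List ℕ)) : List (List ℕ) :=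
  u.foldr (fun a T => insertLetter n a T) T

/-- One step of reverse insertion: letter `g` comes back (moving leftward) into a column;
returns the restored column together with the letter passed further left. -/
def revStep (n g : ℕ) (C : List ℕ) : List ℕ × ℕ :=
  match C with
  | [p] => ([g], p)
  | [p, q] =>
      if p ≠ 0 ∧ p ≤ n ∧ q = bar n p ∧ p ≤ g ∧ g ≤ q then
        ([g, bar n (p - 1)], p - 1)
      else if p ≤ n ∧ g = bar n p ∧ p < q ∧ q < g ∧ p ≠ n then
        ([p + 1, bar n (p + 1)], q)
      else if q ≤ g then ([p, g], q)
      else ([g, q], p)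
  | _ => (C, g)

/-- Reverse insertion of a letter through a list of columns, from right to left;
returns the new columns and the letter ejected from the leftmost column. -/
def revPass (n g : ℕ) : List (List ℕ) → List (List ℕ) × ℕ
  | [] => ([], g)
  | C :: rest =>
      let p := revPass n g rest
      let q := revStep n p.2 C
      (q.1 :: p.1, q.2)

/-- Reverse-bump the rightmost cell of the first row (the last column, a single box). -/
def rbFirst (n : ℕ) (T : List (List ℕ)) : List (List ℕ) × ℕ :=
  match T.getLast? with
  | some [a] => revPass n a T.dropLast
  | _ => (T, 0)

/-- Number of columns of height (at least) two, i.e. the length of the second row. -/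
def numTwoCols (T : List (List ℕ)) : ℕ :=
  (T.filter (fun C => decide (2 ≤ C.length))).length

/-- Reverse-bump the rightmost cell of the second row. -/
def rbSecond (n : ℕ) (T : List (List ℕ)) : List (List ℕ) × ℕ :=
  match (T.drop (numTwoCols T - 1)).head? with
  | some [a, b] =>
      let p := revPass n b (T.take (numTwoCols T - 1))
      (p.1 ++ [a] :: T.drop (numTwoCols T), p.2)
  | _ => (T, 0)

/-- Iterate a reverse-bumping step, collecting the ejected letters in order of ejection. -/
def rbIter (step : List (List ℕ) → List (List ℕ) × ℕ) :
    ℕ → List (List ℕ) → List (List ℕ) × List ℕ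
  | 0, T => (T, [])
  | c + 1, T =>
      let p := step T
      let q := rbIter step c p.1
      (q.1, p.2 :: q.2)

/-- A one-row word regarded as a tableau (list of one-box columns). -/
def rowCols (w : List ℕ) : List (List ℕ) := w.map (fun a => [a])

/-- The row word of a one-row tableau. -/
def colsWord (T : List (List ℕ)) : List ℕ := T.foldr (fun C acc => C ++ acc) []

/-- The word `1^{x_1} ⋯ n^{x_n} n̄^{x̄_n} ⋯ 1̄^{x̄_1}`. -/
def coreWord (n : ℕ) (b : Tup n) : List ℕ :=
  ((List.finRange n).map (fun i => List.replicate (b.1 i) ((i : ℕ) + 1))).foldr (· ++ ·) []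
  ++ ((List.finRange n).reverse.map
      (fun i => List.replicate (b.2 i) (bar n ((i : ℕ) + 1)))).foldr (· ++ ·) []

/-- The word `𝕋(b) = 0^{x_0} 1^{x_1} ⋯ 1̄^{x̄_1} 0̄^{x_0}` of an element of the
`C_n^{(1)}` crystal `B_l`. -/
def rowWordC (n l : ℕ) (b : Tup n) : List ℕ :=
  List.replicate (x0 l b) 0 ++ coreWord n b ++ List.replicate (x0 l b) (bar n 0)

/-- The word `𝕋(b)` with `z` pairs `(0, 0̄)` removed. -/
def hatWordC (n l z : ℕ) (b : Tup n) : List ℕ :=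
  List.replicate (x0 l b - z) 0 ++ coreWord n b ++ List.replicate (x0 l b - z) (bar n 0)

/-- The word `𝒯(b) = 1^{x_1} ⋯ 1̄^{x̄_1}` of an element of the `A_{2n-1}^{(2)}` crystal. -/
def rowWordA (n : ℕ) (b : Tup n) : List ℕ := coreWord n b



set_option linter.unusedSimpArgs false

theorem sSup_iter {α : Type*} (g : α → Option α) (N : α → ℕ) (S : α → Prop)
    (h : ∀ b, S b → (N b = 0 ∧ g b = none) ∨ ∃ c, g b = some c ∧ S c ∧ N c + 1 = N b)
    (b : α) (hb : S b) :
    sSup {m | (fun o => Option.bind o g)^[m] (some b) ≠ none} = N b := by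
  have hn : ∀ m, (fun o => Option.bind o g)^[m] none = none := by
    intro m
    induction m with
    | zero => rfl
    | succ m ih => rw [Function.iterate_succ_apply]; exact ih
  have key : ∀ m b, S b → ((fun o => Option.bind o g)^[m] (some b) ≠ none ↔ m ≤ N b) := by
    intro m
    induction m with
    | zero => intro b _; simp
    | succ m ih =>
      intro b hb
      rw [Function.iterate_succ_apply]
      show (fun o => Option.bind o g)^[m] (g b) ≠ none ↔ _
      rcases h b hb with ⟨h0, hg⟩ | ⟨c, hg, hc, hN⟩
      · rw [hg, hn, h0]; simp
      · rw [hg, ih c hc]; omega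
  have : {m | (fun o => Option.bind o g)^[m] (some b) ≠ none} = Set.Iic (N b) := by
    ext m; exact key m b hb
  rw [this, csSup_Iic]

def wsum {n : ℕ} (c d : ℕ → ℕ) (b : Tup n) : ℕ := ∑ i : Fin n, (c (i+1) * b.1 i + d (i+1) * b.2 i)

theorem tsum_eq {n : ℕ} (b : Tup n) : tsum b = wsum (fun _ => 1) (fun _ => 1) b := by
  simp [tsum, wsum]

theorem xc_setx {n : ℕ} (f g : Fin n → ℕ) (j v i : ℕ) (h1 : 1 ≤ i) (h2 : i ≤ n) :
    xc (setx f j v, g) i = if i = j then v else xc (f, g) i := by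
  have : i - 1 < n := by omega
  simp only [xc, setx, this, dif_pos]
  have : i - 1 + 1 = i := by omega
  simp [this]

theorem xbc_setx {n : ℕ} (f g : Fin n → ℕ) (j v i : ℕ) (h1 : 1 ≤ i) (h2 : i ≤ n) :
    xbc (f, setx g j v) i = if i = j then v else xbc (f, g) i := by
  have : i - 1 < n := by omega
  simp only [xbc, setx, this, dif_pos]
  have : i - 1 + 1 = i := by omega
  simp [this]

theorem setx_sum {n : ℕ} (c : ℕ → ℕ) (f : Fin n → ℕ) (j v : ℕ) (h1 : 1 ≤ j) (h2 : j ≤ n) :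
    (∑ i : Fin n, c (i+1) * setx f j v i) + c j * f ⟨j - 1, by omega⟩ =
      (∑ i : Fin n, c (i+1) * f i) + c j * v := by
  have hj : j - 1 + 1 = j := by omega
  rw [← Finset.add_sum_erase _ _ (Finset.mem_univ (⟨j - 1, by omega⟩ : Fin n)),
    ← Finset.add_sum_erase (a := (⟨j - 1, by omega⟩ : Fin n)) (f := fun i : Fin n => c (i+1) * f i)
      _ (Finset.mem_univ _)]
  have : ∑ i ∈ Finset.univ.erase (⟨j - 1, by omega⟩ : Fin n), c (i+1) * setx f j v i =
      ∑ i ∈ Finset.univ.erase (⟨j - 1, by omega⟩ : Fin n), c (i+1) * f i := by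
    apply Finset.sum_congr rfl
    intro i hi
    have hi : i ≠ _ := Finset.ne_of_mem_erase hi
    have : (i : ℕ) + 1 ≠ j := by
      intro h; apply hi; ext; simp; omega
    simp [setx, this]
  rw [this]
  simp only [setx, hj, if_true]
  ring

theorem wsum_setx {n : ℕ} (c d : ℕ → ℕ) (f g : Fin n → ℕ) (j v : ℕ) (h1 : 1 ≤ j) (h2 : j ≤ n) :
    wsum c d (setx f j v, g) + c j * xc (f, g) j = wsum c d (f, g) + c j * v := by
  have := setx_sum c f j v h1 h2
  have h : j - 1 < n := by omega
  simp only [wsum, Finset.sum_add_distrib, xc, h, dif_pos]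
  omega

theorem wsum_setbx {n : ℕ} (c d : ℕ → ℕ) (f g : Fin n → ℕ) (j v : ℕ) (h1 : 1 ≤ j) (h2 : j ≤ n) :
    wsum c d (f, setx g j v) + d j * xbc (f, g) j = wsum c d (f, g) + d j * v := by
  have := setx_sum d g j v h1 h2
  have h : j - 1 < n := by omega
  simp only [wsum, Finset.sum_add_distrib, xbc, h, dif_pos]
  omega

theorem tsum_setx {n : ℕ} (f g : Fin n → ℕ) (j v : ℕ) (h1 : 1 ≤ j) (h2 : j ≤ n) :
    tsum (setx f j v, g) + xc (f, g) j = tsum (f, g) + v := by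
  simp only [tsum_eq]; simpa using wsum_setx (fun _ => 1) (fun _ => 1) f g j v h1 h2

theorem tsum_setbx {n : ℕ} (f g : Fin n → ℕ) (j v : ℕ) (h1 : 1 ≤ j) (h2 : j ≤ n) :
    tsum (f, setx g j v) + xbc (f, g) j = tsum (f, g) + v := by
  simp only [tsum_eq]; simpa using wsum_setbx (fun _ => 1) (fun _ => 1) f g j v h1 h2

theorem xc_mk {n : ℕ} (f g g' : Fin n → ℕ) (j : ℕ) : xc (f, g) j = xc (f, g') j := rfl

theorem tup_ext {n : ℕ} (b c : Tup n) (h : ∀ i, 1 ≤ i → i ≤ n → xc b i = xc c i)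
    (h' : ∀ i, 1 ≤ i → i ≤ n → xbc b i = xbc c i) : b = c := by
  apply Prod.ext
  · funext t
    have := h (t + 1) (by omega) (by omega)
    simpa [xc] using this
  · funext t
    have := h' (t + 1) (by omega) (by omega)
    simpa [xbc] using this

/-- closed form of epsilon -/
def ep (n l i : ℕ) (b : Tup n) : ℕ :=
  if i = 0 then (l - tsum b) / 2 + (xc b 1 - xbc b 1)
  else if i = n then xbc b n else xbc b i + (xc b (i+1) - xbc b (i+1))

/-- closed form of phi -/
def ph (n l i : ℕ) (b : Tup n) : ℕ :=
  if i = 0 then (l - tsum b) / 2 + (xbc b 1 - xc b 1)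
  else if i = n then xc b n else xc b i + (xbc b (i+1) - xc b (i+1))

def Mw (n : ℕ) (b : Tup n) : ℕ := wsum (fun j => j) (fun j => 2 * n + 1 - j) b

/-- What an operator result must satisfy, in terms of coordinates. -/
theorem e0_spec (n l : ℕ) (hn : 2 ≤ n) (b : Tup n) (hb : memC n l b) :
    (ep n l 0 b = 0 ∧ eC n l 0 b = none) ∨
    ∃ c, eC n l 0 b = some c ∧ memC n l c ∧ ep n l 0 c + 1 = ep n l 0 b ∧
      ph n l 0 c = ph n l 0 b + 1 ∧ fC n l 0 c = some b := by
  obtain ⟨f, g⟩ := b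
  obtain ⟨hb1, hb2⟩ := hb
  have hn0 : 0 < n := by omega
  have hx : ∀ g' v, xc (setx f 1 v, g') 1 = v := fun g' v => by
    rw [xc_setx _ _ _ _ _ le_rfl (by omega)]; simp
  have hy : ∀ f' v, xbc (f', setx g 1 v) 1 = v := fun f' v => by
    rw [xbc_setx _ _ _ _ _ le_rfl (by omega)]; simp
  have hx' : ∀ g', xc (f, g') 1 = xc (f, g) 1 := fun _ => rfl
  have hy' : ∀ f', xbc (f', g) 1 = xbc (f, g) 1 := fun _ => rfl
  have tx := fun v => tsum_setx f g 1 v le_rfl (by omega)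
  have ty := fun v => tsum_setbx f g 1 v le_rfl (by omega)
  have txy := fun v w => tsum_setbx (setx f 1 v) g 1 w le_rfl (by omega)
  simp only [hy'] at txy
  have sx : ∀ v, setx (setx f 1 v) 1 (xc (f, g) 1) = f := by
    intro v; funext t; simp only [setx, xc]
    have : 1 - 1 < n := by omega
    simp only [this, dif_pos]
    split_ifs with h
    · congr; omega
    · rfl
  have sy : ∀ v, setx (setx g 1 v) 1 (xbc (f, g) 1) = g := by
    intro v; funext t; simp only [setx, xbc]
    have : 1 - 1 < n := by omega
    simp only [this, dif_pos]
    split_ifs with h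
    · congr; omega
    · rfl
  simp only [eC, fC, ep, ph, memC, if_true, hn0, hx, hy, hx', hy']
  by_cases h1 : xbc (f, g) 1 + 2 ≤ xc (f, g) 1
  · right
    have t1 := tx (xc (f, g) 1 - 2)
    refine ⟨_, if_pos h1, ?_⟩
    simp only [hx, hy']
    refine ⟨⟨by omega, by omega⟩, by omega, by omega, ?_⟩
    rw [if_pos (by omega), if_pos (by omega)]
    have : xc (f, g) 1 - 2 + 2 = xc (f, g) 1 := by omega
    rw [this, sx]
  rw [if_neg h1]
  by_cases h2 : xc (f, g) 1 = xbc (f, g) 1 + 1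
  · right
    have t1 := tx (xc (f, g) 1 - 1)
    have t2 := txy (xc (f, g) 1 - 1) (xbc (f, g) 1 + 1)
    refine ⟨_, if_pos h2, ?_⟩
    simp only [hx, hy]
    refine ⟨⟨by omega, by omega⟩, by omega, by omega, ?_⟩
    rw [if_neg (by omega), if_pos (by omega)]
    have : xc (f, g) 1 - 1 + 1 = xc (f, g) 1 := by omega
    rw [this, sx, Nat.add_sub_cancel, sy]
  rw [if_neg h2]
  by_cases h3 : tsum (f, g) + 2 ≤ l
  · right
    have t1 := ty (xbc (f, g) 1 + 2)
    refine ⟨_, if_pos h3, ?_⟩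
    simp only [hx', hy]
    refine ⟨⟨by omega, by omega⟩, by omega, by omega, ?_⟩
    rw [if_neg (by omega), if_neg (by omega)]
    rw [Nat.add_sub_cancel, sy]
  · left
    rw [if_neg h3]
    exact ⟨by omega, rfl⟩

theorem f0_spec (n l : ℕ) (hn : 2 ≤ n) (b : Tup n) (hb : memC n l b) :
    (ph n l 0 b = 0 ∧ fC n l 0 b = none) ∨
    ∃ c, fC n l 0 b = some c ∧ memC n l c ∧ ph n l 0 c + 1 = ph n l 0 b ∧
      ep n l 0 c = ep n l 0 b + 1 ∧ eC n l 0 c = some b := by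
  obtain ⟨f, g⟩ := b
  obtain ⟨hb1, hb2⟩ := hb
  have hn0 : 0 < n := by omega
  have hx : ∀ g' v, xc (setx f 1 v, g') 1 = v := fun g' v => by
    rw [xc_setx _ _ _ _ _ le_rfl (by omega)]; simp
  have hy : ∀ f' v, xbc (f', setx g 1 v) 1 = v := fun f' v => by
    rw [xbc_setx _ _ _ _ _ le_rfl (by omega)]; simp
  have hx' : ∀ g', xc (f, g') 1 = xc (f, g) 1 := fun _ => rfl
  have hy' : ∀ f', xbc (f', g) 1 = xbc (f, g) 1 := fun _ => rfl
  have tx := fun v => tsum_setx f g 1 v le_rfl (by omega)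
  have ty := fun v => tsum_setbx f g 1 v le_rfl (by omega)
  have txy := fun v w => tsum_setbx (setx f 1 v) g 1 w le_rfl (by omega)
  simp only [hy'] at txy
  have sx : ∀ v, setx (setx f 1 v) 1 (xc (f, g) 1) = f := by
    intro v; funext t; simp only [setx, xc]
    have : 1 - 1 < n := by omega
    simp only [this, dif_pos]
    split_ifs with h
    · congr; omega
    · rfl
  have sy : ∀ v, setx (setx g 1 v) 1 (xbc (f, g) 1) = g := by
    intro v; funext t; simp only [setx, xbc]
    have : 1 - 1 < n := by omega
    simp only [this, dif_pos]
    split_ifs with h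
    · congr; omega
    · rfl
  simp only [eC, fC, ep, ph, memC, if_true, hn0, hx, hy, hx', hy']
  by_cases h1 : xbc (f, g) 1 ≤ xc (f, g) 1
  · rw [if_pos h1]
    by_cases h3 : tsum (f, g) + 2 ≤ l
    · right
      have t1 := tx (xc (f, g) 1 + 2)
      refine ⟨_, if_pos h3, ?_⟩
      simp only [hx, hy']
      refine ⟨⟨by omega, by omega⟩, by omega, by omega, ?_⟩
      rw [if_pos (by omega)]
      rw [Nat.add_sub_cancel, sx]
    · left
      rw [if_neg h3]
      exact ⟨by omega, rfl⟩
  rw [if_neg h1]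
  by_cases h2 : xc (f, g) 1 + 1 = xbc (f, g) 1
  · right
    have t1 := tx (xc (f, g) 1 + 1)
    have t2 := txy (xc (f, g) 1 + 1) (xbc (f, g) 1 - 1)
    refine ⟨_, if_pos h2, ?_⟩
    simp only [hx, hy]
    refine ⟨⟨by omega, by omega⟩, by omega, by omega, ?_⟩
    rw [if_neg (by omega), if_pos (by omega)]
    have : xbc (f, g) 1 - 1 + 1 = xbc (f, g) 1 := by omega
    rw [this, sy, Nat.add_sub_cancel, sx]
  · right
    rw [if_neg h2]
    have t1 := ty (xbc (f, g) 1 - 2)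
    refine ⟨_, rfl, ?_⟩
    simp only [hx', hy]
    refine ⟨⟨by omega, by omega⟩, by omega, by omega, ?_⟩
    rw [if_neg (by omega), if_neg (by omega), if_pos (by omega)]
    have : xbc (f, g) 1 - 2 + 2 = xbc (f, g) 1 := by omega
    rw [this, sy]

theorem sx_lem {n : ℕ} (f g : Fin n → ℕ) (j v : ℕ) (h1 : 1 ≤ j) (h2 : j ≤ n) :
    setx (setx f j v) j (xc (f, g) j) = f := by
  funext t; simp only [setx, xc]
  have : j - 1 < n := by omega
  simp only [this, dif_pos]
  split_ifs with h
  · congr; omega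
  · rfl

theorem sx2_lem {n : ℕ} (f g : Fin n → ℕ) (i j v w : ℕ) (h1 : 1 ≤ j) (h2 : j ≤ n)
    (h1' : 1 ≤ i) (h2' : i ≤ n) :
    setx (setx (setx (setx f i v) j w) i (xc (f, g) i)) j (xc (f, g) j) = f := by
  funext t; simp only [setx, xc]
  have : j - 1 < n := by omega
  have : i - 1 < n := by omega
  simp only [*, dif_pos]
  split_ifs with h h'
  · congr; omega
  · congr; omega
  · rfl

theorem sy_lem {n : ℕ} (f g : Fin n → ℕ) (j v : ℕ) (h1 : 1 ≤ j) (h2 : j ≤ n) :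
    setx (setx g j v) j (xbc (f, g) j) = g := sx_lem g f j v h1 h2

theorem sy2_lem {n : ℕ} (f g : Fin n → ℕ) (i j v w : ℕ) (h1 : 1 ≤ j) (h2 : j ≤ n)
    (h1' : 1 ≤ i) (h2' : i ≤ n) :
    setx (setx (setx (setx g i v) j w) i (xbc (f, g) i)) j (xbc (f, g) j) = g :=
  sx2_lem g f i j v w h1 h2 h1' h2'

theorem en_spec (n l : ℕ) (hn : 2 ≤ n) (b : Tup n) :
    (ep n l n b = 0 ∧ eC n l n b = none) ∨
    ∃ c, eC n l n b = some c ∧ tsum c = tsum b ∧ Mw n c < Mw n b ∧ ep n l n c + 1 = ep n l n b ∧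
      ph n l n c = ph n l n b + 1 ∧ fC n l n c = some b := by
  obtain ⟨f, g⟩ := b
  have hn0 : n ≠ 0 := by omega
  simp only [eC, fC, ep, ph, if_true, hn0, if_false]
  by_cases h1 : 0 < xbc (f, g) n
  · right
    refine ⟨_, if_pos h1, ?_⟩
    have t1 := tsum_setx f g n (xc (f, g) n + 1) (by omega) le_rfl
    have t2 := tsum_setbx (setx f n (xc (f, g) n + 1)) g n (xbc (f, g) n - 1) (by omega) le_rfl
    have m1 := wsum_setx (fun j => j) (fun j => 2 * n + 1 - j) f g n (xc (f, g) n + 1)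
      (by omega) le_rfl
    have m2 := wsum_setbx (fun j => j) (fun j => 2 * n + 1 - j) (setx f n (xc (f, g) n + 1)) g n
      (xbc (f, g) n - 1) (by omega) le_rfl
    have e1 : ∀ f', xbc (f', g) n = xbc (f, g) n := fun _ => rfl
    rw [e1 (setx f n _)] at t2 m2
    have hx : ∀ g' v, xc (setx f n v, g') n = v := fun g' v => by
      rw [xc_setx _ _ _ _ _ (by omega) le_rfl]; simp
    have hy : ∀ f' v, xbc (f', setx g n v) n = v := fun f' v => by
      rw [xbc_setx _ _ _ _ _ (by omega) le_rfl]; simp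
    refine ⟨by omega, ?_, ?_⟩
    · simp only [Mw]
      obtain ⟨y, hy⟩ : ∃ y, xbc (f, g) n = y + 1 := ⟨_, (Nat.sub_add_cancel h1).symm⟩
      have e3 : 2 * n + 1 - n = n + 1 := by omega
      simp only [hy, e3, Nat.add_sub_cancel] at m1 m2 ⊢
      nlinarith
    simp only [hx, hy]
    refine ⟨by omega, trivial, ?_⟩
    rw [if_pos (by omega)]
    have e2 : xbc (f, g) n - 1 + 1 = xbc (f, g) n := by omega
    rw [e2, Nat.add_sub_cancel, sx_lem _ _ _ _ (by omega) le_rfl, sy_lem _ _ _ _ (by omega) le_rfl]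
  · left
    exact ⟨by omega, if_neg h1⟩

theorem fn_spec (n l : ℕ) (hn : 2 ≤ n) (b : Tup n) :
    (ph n l n b = 0 ∧ fC n l n b = none) ∨
    ∃ c, fC n l n b = some c ∧ tsum c = tsum b ∧ ph n l n c + 1 = ph n l n b ∧
      ep n l n c = ep n l n b + 1 ∧ eC n l n c = some b := by
  obtain ⟨f, g⟩ := b
  have hn0 : n ≠ 0 := by omega
  simp only [eC, fC, ep, ph, if_true, hn0, if_false]
  by_cases h1 : 0 < xc (f, g) n
  · right
    refine ⟨_, if_pos h1, ?_⟩
    have t1 := tsum_setx f g n (xc (f, g) n - 1) (by omega) le_rfl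
    have t2 := tsum_setbx (setx f n (xc (f, g) n - 1)) g n (xbc (f, g) n + 1) (by omega) le_rfl
    have e1 : ∀ f', xbc (f', g) n = xbc (f, g) n := fun _ => rfl
    rw [e1 (setx f n _)] at t2
    have hx : ∀ g' v, xc (setx f n v, g') n = v := fun g' v => by
      rw [xc_setx _ _ _ _ _ (by omega) le_rfl]; simp
    have hy : ∀ f' v, xbc (f', setx g n v) n = v := fun f' v => by
      rw [xbc_setx _ _ _ _ _ (by omega) le_rfl]; simp
    refine ⟨by omega, ?_⟩
    simp only [hx, hy]
    refine ⟨by omega, trivial, ?_⟩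
    rw [if_pos (by omega)]
    have e2 : xc (f, g) n - 1 + 1 = xc (f, g) n := by omega
    rw [e2, Nat.add_sub_cancel, sx_lem _ _ _ _ (by omega) le_rfl, sy_lem _ _ _ _ (by omega) le_rfl]
  · left
    exact ⟨by omega, if_neg h1⟩

theorem ei_spec (n l i : ℕ) (hi : 1 ≤ i) (hin : i < n) (b : Tup n) :
    (ep n l i b = 0 ∧ eC n l i b = none) ∨
    ∃ c, eC n l i b = some c ∧ tsum c = tsum b ∧ Mw n c < Mw n b ∧ ep n l i c + 1 = ep n l i b ∧
      ph n l i c = ph n l i b + 1 ∧ fC n l i c = some b := by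
  obtain ⟨f, g⟩ := b
  have hn0 : i ≠ 0 := by omega
  have hn1 : i ≠ n := by omega
  have xx : ∀ (f' g' : Fin n → ℕ) (a v : ℕ), xc (setx f' a v, g') i = if i = a then v else xc (f', g') i :=
    fun f' g' a v => xc_setx _ _ _ _ _ (by omega) (by omega)
  have yy : ∀ (f' g' : Fin n → ℕ) (a v : ℕ), xbc (f', setx g' a v) i = if i = a then v else xbc (f', g') i :=
    fun f' g' a v => xbc_setx _ _ _ _ _ (by omega) (by omega)
  have xx1 : ∀ (f' g' : Fin n → ℕ) (a v : ℕ), xc (setx f' a v, g') (i+1) = if i + 1 = a then v else xc (f', g') (i+1) :=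
    fun f' g' a v => xc_setx _ _ _ _ _ (by omega) (by omega)
  have yy1 : ∀ (f' g' : Fin n → ℕ) (a v : ℕ), xbc (f', setx g' a v) (i+1) = if i + 1 = a then v else xbc (f', g') (i+1) :=
    fun f' g' a v => xbc_setx _ _ _ _ _ (by omega) (by omega)
  have ex : ∀ g' j, xc (f, g') j = xc (f, g) j := fun _ _ => rfl
  have ey : ∀ f' j, xbc (f', g) j = xbc (f, g) j := fun _ _ => rfl
  have ne : i ≠ i + 1 := by omega
  have ne' : i + 1 ≠ i := by omega
  simp only [eC, fC, ep, ph, if_true, hn0, hn1, hin, if_false]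
  by_cases h1 : xbc (f, g) (i+1) < xc (f, g) (i+1)
  · right
    refine ⟨_, if_pos h1, ?_⟩
    have t1 := tsum_setx f g i (xc (f, g) i + 1) (by omega) (by omega)
    have t2 := tsum_setx (setx f i (xc (f, g) i + 1)) g (i+1) (xc (f, g) (i+1) - 1)
      (by omega) (by omega)
    have m1 := wsum_setx (fun j => j) (fun j => 2 * n + 1 - j) f g i (xc (f, g) i + 1)
      (by omega) (by omega)
    have m2 := wsum_setx (fun j => j) (fun j => 2 * n + 1 - j) (setx f i (xc (f, g) i + 1)) g (i+1)
      (xc (f, g) (i+1) - 1) (by omega) (by omega)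
    rw [xx1, if_neg ne'] at t2 m2
    refine ⟨by omega, ?_, ?_⟩
    · simp only [Mw]
      obtain ⟨y, hy⟩ : ∃ y, xc (f, g) (i+1) = y + 1 := ⟨_, (Nat.sub_add_cancel (by omega)).symm⟩
      simp only [hy, Nat.add_sub_cancel] at m1 m2 ⊢
      nlinarith
    simp only [xx, yy, xx1, yy1, if_true, ne, ne', if_false, ey]
    refine ⟨by omega, by omega, ?_⟩
    rw [if_pos (by omega), if_pos (by omega)]
    have e2 : xc (f, g) (i+1) - 1 + 1 = xc (f, g) (i+1) := by omega
    rw [e2, Nat.add_sub_cancel, sx2_lem] <;> omega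
  rw [if_neg h1]
  by_cases h2 : 0 < xbc (f, g) i
  · right
    refine ⟨_, if_pos h2, ?_⟩
    have t1 := tsum_setbx f g (i+1) (xbc (f, g) (i+1) + 1) (by omega) (by omega)
    have t2 := tsum_setbx f (setx g (i+1) (xbc (f, g) (i+1) + 1)) i (xbc (f, g) i - 1)
      (by omega) (by omega)
    have m1 := wsum_setbx (fun j => j) (fun j => 2 * n + 1 - j) f g (i+1) (xbc (f, g) (i+1) + 1)
      (by omega) (by omega)
    have m2 := wsum_setbx (fun j => j) (fun j => 2 * n + 1 - j) f
      (setx g (i+1) (xbc (f, g) (i+1) + 1)) i (xbc (f, g) i - 1) (by omega) (by omega)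
    rw [yy, if_neg ne] at t2 m2
    refine ⟨by omega, ?_, ?_⟩
    · simp only [Mw]
      obtain ⟨y, hy⟩ : ∃ y, xbc (f, g) i = y + 1 := ⟨_, (Nat.sub_add_cancel (by omega)).symm⟩
      obtain ⟨p, hp⟩ : ∃ p, 2 * n + 1 - i = p + 1 := ⟨2 * n - i, by omega⟩
      have hp' : 2 * n + 1 - (i + 1) = p := by omega
      simp only [hy, hp, hp', Nat.add_sub_cancel] at m1 m2 ⊢
      nlinarith
    simp only [xx, yy, xx1, yy1, if_true, ne, ne', if_false, ex]
    refine ⟨by omega, by omega, ?_⟩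
    rw [if_neg (by omega)]
    have e2 : xbc (f, g) i - 1 + 1 = xbc (f, g) i := by omega
    rw [e2, Nat.add_sub_cancel, sy2_lem] <;> omega
  · left
    exact ⟨by omega, if_neg h2⟩

theorem fi_spec (n l i : ℕ) (hi : 1 ≤ i) (hin : i < n) (b : Tup n) :
    (ph n l i b = 0 ∧ fC n l i b = none) ∨
    ∃ c, fC n l i b = some c ∧ tsum c = tsum b ∧ ph n l i c + 1 = ph n l i b ∧
      ep n l i c = ep n l i b + 1 ∧ eC n l i c = some b := by
  obtain ⟨f, g⟩ := b
  have hn0 : i ≠ 0 := by omega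
  have hn1 : i ≠ n := by omega
  have xx : ∀ (f' g' : Fin n → ℕ) (a v : ℕ), xc (setx f' a v, g') i = if i = a then v else xc (f', g') i :=
    fun f' g' a v => xc_setx _ _ _ _ _ (by omega) (by omega)
  have yy : ∀ (f' g' : Fin n → ℕ) (a v : ℕ), xbc (f', setx g' a v) i = if i = a then v else xbc (f', g') i :=
    fun f' g' a v => xbc_setx _ _ _ _ _ (by omega) (by omega)
  have xx1 : ∀ (f' g' : Fin n → ℕ) (a v : ℕ), xc (setx f' a v, g') (i+1) = if i + 1 = a then v else xc (f', g') (i+1) :=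
    fun f' g' a v => xc_setx _ _ _ _ _ (by omega) (by omega)
  have yy1 : ∀ (f' g' : Fin n → ℕ) (a v : ℕ), xbc (f', setx g' a v) (i+1) = if i + 1 = a then v else xbc (f', g') (i+1) :=
    fun f' g' a v => xbc_setx _ _ _ _ _ (by omega) (by omega)
  have ex : ∀ g' j, xc (f, g') j = xc (f, g) j := fun _ _ => rfl
  have ey : ∀ f' j, xbc (f', g) j = xbc (f, g) j := fun _ _ => rfl
  have ne : i ≠ i + 1 := by omega
  have ne' : i + 1 ≠ i := by omega
  simp only [eC, fC, ep, ph, if_true, hn0, hn1, hin, if_false]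
  by_cases h1 : xbc (f, g) (i+1) ≤ xc (f, g) (i+1)
  · rw [if_pos h1]
    by_cases h2 : 0 < xc (f, g) i
    · right
      refine ⟨_, if_pos h2, ?_⟩
      have t1 := tsum_setx f g i (xc (f, g) i - 1) (by omega) (by omega)
      have t2 := tsum_setx (setx f i (xc (f, g) i - 1)) g (i+1) (xc (f, g) (i+1) + 1)
        (by omega) (by omega)
      rw [xx1, if_neg ne'] at t2
      refine ⟨by omega, ?_⟩
      simp only [xx, yy, xx1, yy1, if_true, ne, ne', if_false, ey]
      refine ⟨by omega, by omega, ?_⟩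
      rw [if_pos (by omega)]
      have e2 : xc (f, g) i - 1 + 1 = xc (f, g) i := by omega
      rw [e2, Nat.add_sub_cancel, sx2_lem] <;> omega
    · left
      exact ⟨by omega, if_neg h2⟩
  · right
    rw [if_neg h1]
    refine ⟨_, rfl, ?_⟩
    have t1 := tsum_setbx f g (i+1) (xbc (f, g) (i+1) - 1) (by omega) (by omega)
    have t2 := tsum_setbx f (setx g (i+1) (xbc (f, g) (i+1) - 1)) i (xbc (f, g) i + 1)
      (by omega) (by omega)
    rw [yy, if_neg ne] at t2
    refine ⟨by omega, ?_⟩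
    simp only [xx, yy, xx1, yy1, if_true, ne, ne', if_false, ex]
    refine ⟨by omega, by omega, ?_⟩
    rw [if_neg (by omega), if_pos (by omega)]
    have e2 : xbc (f, g) (i+1) - 1 + 1 = xbc (f, g) (i+1) := by omega
    rw [e2, Nat.add_sub_cancel, sy2_lem] <;> omega

theorem e_spec (n l i : ℕ) (hn : 2 ≤ n) (hi : i ≤ n) (b : Tup n) (hb : memC n l b) :
    (ep n l i b = 0 ∧ eC n l i b = none) ∨
    ∃ c, eC n l i b = some c ∧ memC n l c ∧ ep n l i c + 1 = ep n l i b ∧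
      ph n l i c = ph n l i b + 1 ∧ fC n l i c = some b ∧
      (1 ≤ i → tsum c = tsum b ∧ Mw n c < Mw n b) := by
  rcases Nat.eq_zero_or_pos i with rfl | h0
  · rcases e0_spec n l hn b hb with h | ⟨c, h1, h2, h3, h4, h5⟩
    · exact Or.inl h
    · exact Or.inr ⟨c, h1, h2, h3, h4, h5, by omega⟩
  rcases Nat.lt_or_ge i n with h | h
  · rcases ei_spec n l i h0 h b with h | ⟨c, h1, h2, h2', h3, h4, h5⟩
    · exact Or.inl h
    · exact Or.inr ⟨c, h1, by simpa only [memC, h2] using hb, h3, h4, h5, fun _ => ⟨h2, h2'⟩⟩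
  · obtain rfl : i = n := by omega
    rcases en_spec i l hn b with h | ⟨c, h1, h2, h2', h3, h4, h5⟩
    · exact Or.inl h
    · exact Or.inr ⟨c, h1, by simpa only [memC, h2] using hb, h3, h4, h5, fun _ => ⟨h2, h2'⟩⟩

theorem f_spec (n l i : ℕ) (hn : 2 ≤ n) (hi : i ≤ n) (b : Tup n) (hb : memC n l b) :
    (ph n l i b = 0 ∧ fC n l i b = none) ∨
    ∃ c, fC n l i b = some c ∧ memC n l c ∧ ph n l i c + 1 = ph n l i b ∧
      ep n l i c = ep n l i b + 1 ∧ eC n l i c = some b := by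
  rcases Nat.eq_zero_or_pos i with rfl | h0
  · exact f0_spec n l hn b hb
  rcases Nat.lt_or_ge i n with h | h
  · rcases fi_spec n l i h0 h b with h | ⟨c, h1, h2, h3, h4, h5⟩
    · exact Or.inl h
    · exact Or.inr ⟨c, h1, by simpa only [memC, h2] using hb, h3, h4, h5⟩
  · obtain rfl : i = n := by omega
    rcases fn_spec i l hn b with h | ⟨c, h1, h2, h3, h4, h5⟩
    · exact Or.inl h
    · exact Or.inr ⟨c, h1, by simpa only [memC, h2] using hb, h3, h4, h5⟩

theorem epsC_eq (n l i : ℕ) (hn : 2 ≤ n) (hi : i ≤ n) (b : Tup n) (hb : memC n l b) :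
    epsC n l i b = ep n l i b := by
  refine sSup_iter (eC n l i) (ep n l i) (memC n l) ?_ b hb
  intro b hb
  rcases e_spec n l i hn hi b hb with h | ⟨c, h1, h2, h3, h4, h5⟩
  · exact Or.inl h
  · exact Or.inr ⟨c, h1, h2, h3⟩

theorem phiC_eq (n l i : ℕ) (hn : 2 ≤ n) (hi : i ≤ n) (b : Tup n) (hb : memC n l b) :
    phiC n l i b = ph n l i b := by
  refine sSup_iter (fC n l i) (ph n l i) (memC n l) ?_ b hb
  intro b hb
  rcases f_spec n l i hn hi b hb with h | ⟨c, h1, h2, h3, h4, h5⟩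
  · exact Or.inl h
  · exact Or.inr ⟨c, h1, h2, h3⟩

def tE (n l k i : ℕ) (u : Tup n × Tup n) : ℕ := ep n l i u.1 + (ep n k i u.2 - ph n l i u.1)
def tF (n l k i : ℕ) (u : Tup n × Tup n) : ℕ := ph n k i u.2 + (ph n l i u.1 - ep n k i u.2)

theorem eTen_eq (n l k i : ℕ) (hn : 2 ≤ n) (hi : i ≤ n) (b1 b2 : Tup n) (hb1 : memC n l b1)
    (hb2 : memC n k b2) : eTenC n l k i (b1, b2) =
      if ep n k i b2 ≤ ph n l i b1 then (eC n l i b1).map (fun c => (c, b2))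
      else (eC n k i b2).map (fun c => (b1, c)) := by
  simp only [eTenC, epsC_eq n k i hn hi b2 hb2, phiC_eq n l i hn hi b1 hb1]

theorem fTen_eq (n l k i : ℕ) (hn : 2 ≤ n) (hi : i ≤ n) (b1 b2 : Tup n) (hb1 : memC n l b1)
    (hb2 : memC n k b2) : fTenC n l k i (b1, b2) =
      if ep n k i b2 < ph n l i b1 then (fC n l i b1).map (fun c => (c, b2))
      else (fC n k i b2).map (fun c => (b1, c)) := by
  simp only [fTenC, epsC_eq n k i hn hi b2 hb2, phiC_eq n l i hn hi b1 hb1]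

theorem eTen_spec (n l k i : ℕ) (hn : 2 ≤ n) (hi : i ≤ n) (b1 b2 : Tup n) (hb1 : memC n l b1)
    (hb2 : memC n k b2) :
    (tE n l k i (b1, b2) = 0 ∧ eTenC n l k i (b1, b2) = none) ∨
    ∃ v : Tup n × Tup n, eTenC n l k i (b1, b2) = some v ∧ memC n l v.1 ∧ memC n k v.2 ∧
      tE n l k i v + 1 = tE n l k i (b1, b2) ∧ fTenC n l k i v = some (b1, b2) ∧
      (1 ≤ i → Mw n v.1 + Mw n v.2 < Mw n b1 + Mw n b2) := by
  rw [eTen_eq n l k i hn hi b1 b2 hb1 hb2]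
  simp only [tE]
  split_ifs with h
  · rcases e_spec n l i hn hi b1 hb1 with ⟨h1, h2⟩ | ⟨c, h1, h2, h3, h4, h5, h6⟩
    · left; rw [h2]; exact ⟨by omega, rfl⟩
    · right
      refine ⟨(c, b2), by rw [h1]; rfl, h2, hb2, by simp only; omega, ?_, ?_⟩
      · rw [fTen_eq n l k i hn hi c b2 h2 hb2, if_pos (by omega), h5]; rfl
      · intro h; have := h6 h; simp only; omega
  · rcases e_spec n k i hn hi b2 hb2 with ⟨h1, h2⟩ | ⟨c, h1, h2, h3, h4, h5, h6⟩
    · omega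
    · right
      refine ⟨(b1, c), by rw [h1]; rfl, hb1, h2, by simp only; omega, ?_, ?_⟩
      · rw [fTen_eq n l k i hn hi b1 c hb1 h2, if_neg (by omega), h5]; rfl
      · intro h; have := h6 h; simp only; omega

theorem fTen_spec (n l k i : ℕ) (hn : 2 ≤ n) (hi : i ≤ n) (b1 b2 : Tup n) (hb1 : memC n l b1)
    (hb2 : memC n k b2) :
    (tF n l k i (b1, b2) = 0 ∧ fTenC n l k i (b1, b2) = none) ∨
    ∃ v : Tup n × Tup n, fTenC n l k i (b1, b2) = some v ∧ memC n l v.1 ∧ memC n k v.2 ∧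
      tF n l k i v + 1 = tF n l k i (b1, b2) := by
  rw [fTen_eq n l k i hn hi b1 b2 hb1 hb2]
  simp only [tF]
  split_ifs with h
  · rcases f_spec n l i hn hi b1 hb1 with ⟨h1, h2⟩ | ⟨c, h1, h2, h3, h4, h5⟩
    · omega
    · right
      exact ⟨(c, b2), by rw [h1]; rfl, h2, hb2, by simp only; omega⟩
  · rcases f_spec n k i hn hi b2 hb2 with ⟨h1, h2⟩ | ⟨c, h1, h2, h3, h4, h5⟩
    · left; rw [h2]; exact ⟨by omega, rfl⟩
    · right
      exact ⟨(b1, c), by rw [h1]; rfl, hb1, h2, by simp only; omega⟩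

theorem iso_mem {n l k : ℕ} {ι : Tup n × Tup n → Tup n × Tup n} (hι : IsIsoC n l k ι)
    (u : Tup n × Tup n) (h1 : memC n l u.1) (h2 : memC n k u.2) :
    memC n k (ι u).1 ∧ memC n l (ι u).2 := hι.1.mapsTo (x := u) ⟨h1, h2⟩

theorem iso_tE {n l k : ℕ} {ι : Tup n × Tup n → Tup n × Tup n} (hι : IsIsoC n l k ι)
    (hn : 2 ≤ n) (i : ℕ) (hi : i ≤ n) : ∀ N (u : Tup n × Tup n), memC n l u.1 → memC n k u.2 →
    tE n l k i u = N → tE n k l i (ι u) = N := by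
  intro N
  induction N with
  | zero =>
    intro u h1 h2 hN
    have hm := iso_mem hι u h1 h2
    have hu := (hι.2 u ⟨h1, h2⟩ i hi).1
    rcases eTen_spec n l k i hn hi u.1 u.2 h1 h2 with ⟨_, h⟩ | ⟨v, h, h3, h4, h5, h6, _⟩
    · have h : eTenC n l k i u = none := h
      rw [h] at hu
      rcases eTen_spec n k l i hn hi _ _ hm.1 hm.2 with ⟨h', _⟩ | ⟨v, h', _⟩
      · exact h'
      · have h' : eTenC n k l i (ι u) = some v := h'
        rw [h'] at hu; simp at hu
    · change _ = tE n l k i u at h5; omega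
  | succ N ih =>
    intro u h1 h2 hN
    have hm := iso_mem hι u h1 h2
    have hu := (hι.2 u ⟨h1, h2⟩ i hi).1
    rcases eTen_spec n l k i hn hi u.1 u.2 h1 h2 with ⟨h', h⟩ | ⟨v, h, h3, h4, h5, h6, _⟩
    · change tE n l k i u = 0 at h'; omega
    · have h : eTenC n l k i u = some v := h
      change _ = tE n l k i u at h5
      rw [h] at hu
      have iv := ih v h3 h4 (by omega)
      rcases eTen_spec n k l i hn hi _ _ hm.1 hm.2 with ⟨_, h'⟩ | ⟨w, h', _, _, h8, _⟩
      · have h' : eTenC n k l i (ι u) = none := h'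
        rw [h'] at hu; simp at hu
      · have h' : eTenC n k l i (ι u) = some w := h'
        rw [h'] at hu; simp at hu
        change _ = tE n k l i (ι u) at h8
        rw [← hu] at h8; omega

theorem iso_tF {n l k : ℕ} {ι : Tup n × Tup n → Tup n × Tup n} (hι : IsIsoC n l k ι)
    (hn : 2 ≤ n) (i : ℕ) (hi : i ≤ n) : ∀ N (u : Tup n × Tup n), memC n l u.1 → memC n k u.2 →
    tF n l k i u = N → tF n k l i (ι u) = N := by
  intro N
  induction N with
  | zero =>
    intro u h1 h2 hN
    have hm := iso_mem hι u h1 h2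
    have hu := (hι.2 u ⟨h1, h2⟩ i hi).2
    rcases fTen_spec n l k i hn hi u.1 u.2 h1 h2 with ⟨_, h⟩ | ⟨v, h, h3, h4, h5⟩
    · have h : fTenC n l k i u = none := h
      rw [h] at hu
      rcases fTen_spec n k l i hn hi _ _ hm.1 hm.2 with ⟨h', _⟩ | ⟨v, h', _⟩
      · exact h'
      · have h' : fTenC n k l i (ι u) = some v := h'
        rw [h'] at hu; simp at hu
    · change _ = tF n l k i u at h5; omega
  | succ N ih =>
    intro u h1 h2 hN
    have hm := iso_mem hι u h1 h2
    have hu := (hι.2 u ⟨h1, h2⟩ i hi).2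
    rcases fTen_spec n l k i hn hi u.1 u.2 h1 h2 with ⟨h', h⟩ | ⟨v, h, h3, h4, h5⟩
    · change tF n l k i u = 0 at h'; omega
    · have h : fTenC n l k i u = some v := h
      change _ = tF n l k i u at h5
      rw [h] at hu
      have iv := ih v h3 h4 (by omega)
      rcases fTen_spec n k l i hn hi _ _ hm.1 hm.2 with ⟨_, h'⟩ | ⟨w, h', _, _, h8⟩
      · have h' : fTenC n k l i (ι u) = none := h'
        rw [h'] at hu; simp at hu
      · have h' : fTenC n k l i (ι u) = some w := h'
        rw [h'] at hu; simp at hu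
        change _ = tF n k l i (ι u) at h8
        rw [← hu] at h8; omega

/-! special vectors -/

theorem tv_x1 (n a c d : ℕ) (hn : 2 ≤ n) : xc (tripleVec n a c d) 1 = a := by
  have : 1 - 1 < n := by omega
  simp only [xc, tripleVec, this, dif_pos]; simp
theorem tv_x2 (n a c d : ℕ) (hn : 2 ≤ n) : xc (tripleVec n a c d) 2 = c := by
  have : 2 - 1 < n := by omega
  simp only [xc, tripleVec, this, dif_pos]; simp
theorem tv_y1 (n a c d : ℕ) (hn : 2 ≤ n) : xbc (tripleVec n a c d) 1 = d := by
  have : 1 - 1 < n := by omega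
  simp only [xbc, tripleVec, this, dif_pos]; simp
theorem tv_x (n a c d i : ℕ) (hi : 3 ≤ i) : xc (tripleVec n a c d) i = 0 := by
  have : ¬ i - 1 = 0 := by omega
  have : ¬ i - 1 = 1 := by omega
  simp [xc, tripleVec, *]
theorem tv_y (n a c d i : ℕ) (hi : 2 ≤ i) : xbc (tripleVec n a c d) i = 0 := by
  have : ¬ i - 1 = 0 := by omega
  simp [xbc, tripleVec, *]

theorem tsum_zero {n : ℕ} (b : Tup n) (h : tsum b = 0) : (∀ i, xc b i = 0) ∧ ∀ i, xbc b i = 0 := by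
  simp only [tsum, Finset.sum_eq_zero_iff, Finset.mem_univ, true_implies] at h
  constructor
  · intro i; simp only [xc]; split_ifs with hh
    · have := h ⟨i - 1, hh⟩; omega
    · rfl
  · intro i; simp only [xbc]; split_ifs with hh
    · have := h ⟨i - 1, hh⟩; omega
    · rfl

theorem tsum12 {n : ℕ} (hn : 2 ≤ n) (b : Tup n) :
    xc b 1 + xc b 2 ≤ tsum b ∧
      (tsum b ≤ xc b 1 + xc b 2 → b = tripleVec n (xc b 1) (xc b 2) 0) := by
  obtain ⟨f, g⟩ := b
  have t1 := tsum_setx f g 1 0 (by omega) (by omega)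
  have t2 := tsum_setx (setx f 1 0) g 2 0 (by omega) (by omega)
  rw [xc_setx _ _ _ _ _ (by omega) (by omega), if_neg (by omega)] at t2
  refine ⟨by omega, fun h => ?_⟩
  have := tsum_zero _ (show tsum (setx (setx f 1 0) 2 0, g) = 0 by omega)
  apply tup_ext
  · intro i h1 h2
    have hz := this.1 i
    rw [xc_setx _ _ _ _ _ h1 h2, xc_setx _ _ _ _ _ h1 h2] at hz
    by_cases e1 : i = 1
    · subst e1; rw [tv_x1 _ _ _ _ hn]
    by_cases e2 : i = 2
    · subst e2; rw [tv_x2 _ _ _ _ hn]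
    rw [if_neg e2, if_neg e1] at hz
    rw [hz, tv_x _ _ _ _ _ (by omega)]
  · intro i h1 h2
    have hz := this.2 i
    by_cases e1 : i = 1
    · subst e1; rw [tv_y1 _ _ _ _ hn]; exact hz
    rw [tv_y _ _ _ _ _ (by omega)]; exact hz

theorem tv_tsum (n a c d : ℕ) (hn : 2 ≤ n) : tsum (tripleVec n a c d) = a + c + d := by
  have h0 : tsum (tripleVec n a c d) = (∑ i, (tripleVec n a c d).1 i) + ∑ i, (tripleVec n a c d).2 i := by
    simp [tsum, Finset.sum_add_distrib]
  obtain ⟨m, rfl⟩ : ∃ m, n = m + 2 := ⟨n - 2, by omega⟩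
  rw [h0]
  simp [tripleVec, Fin.sum_univ_succ]

theorem uvec_tv (n l : ℕ) : uvec n l = tripleVec n l 0 0 := by
  simp [uvec, tripleVec]
theorem u2vec_tv (n l : ℕ) : u2vec n l = tripleVec n 0 l 0 := by
  simp only [u2vec, tripleVec]
  apply Prod.ext
  · funext j; simp only; split_ifs <;> omega
  · simp

theorem tv_mem (n l a c d : ℕ) (hn : 2 ≤ n) (h : a + c + d ≤ l) (h' : (l - (a + c + d)) % 2 = 0) :
    memC n l (tripleVec n a c d) := by
  simp only [memC, tv_tsum _ _ _ _ hn]; exact ⟨h, h'⟩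

theorem tv_ep0 (n l a c d : ℕ) (hn : 2 ≤ n) :
    ep n l 0 (tripleVec n a c d) = (l - (a + c + d)) / 2 + (a - d) := by
  simp [ep, tv_tsum, tv_x1, tv_y1, hn]
theorem tv_ph0 (n l a c d : ℕ) (hn : 2 ≤ n) :
    ph n l 0 (tripleVec n a c d) = (l - (a + c + d)) / 2 + (d - a) := by
  simp [ph, tv_tsum, tv_x1, tv_y1, hn]
theorem tv_ep1 (n l a c d : ℕ) (hn : 2 ≤ n) : ep n l 1 (tripleVec n a c d) = d + c := by
  have : ¬ 1 = n := by omega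
  simp [ep, tv_x2, tv_y1, tv_y, hn, this]
theorem tv_ph1 (n l a c d : ℕ) (hn : 2 ≤ n) : ph n l 1 (tripleVec n a c d) = a := by
  have : ¬ 1 = n := by omega
  simp [ph, tv_x2, tv_x1, tv_y, hn, this]
theorem tv_ph (n l d i : ℕ) (h1 : 1 ≤ i) : ph n l i (tripleVec n 0 0 d) = 0 := by
  have hx : ∀ i, xc (tripleVec n 0 0 d) i = 0 := by intro i; simp [xc, tripleVec]
  have : ¬ i = 0 := by omega
  simp [ph, hx, tv_y, this, h1]
theorem tv_ep (n l a i : ℕ) (h1 : 1 ≤ i) : ep n l i (tripleVec n a 0 0) = 0 := by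
  have hx : ∀ i, xbc (tripleVec n a 0 0) i = 0 := by intro i; simp [xbc, tripleVec]
  have : ¬ i = 0 := by omega
  have h2 : xc (tripleVec n a 0 0) (i+1) = 0 := by simp [xc, tripleVec, this]
  simp [ep, hx, this, h2]

theorem tv_e0 (n l a c : ℕ) (hn : 2 ≤ n) :
    eC n l 0 (tripleVec n (a+2) c 0) = some (tripleVec n a c 0) := by
  have : 0 < n := by omega
  simp only [eC, if_true, this, tv_x1 _ _ _ _ hn, tv_y1 _ _ _ _ hn]
  rw [if_pos (by omega)]
  congr 1
  apply Prod.ext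
  · funext t; simp only [setx, tripleVec]; split_ifs <;> omega
  · rfl

theorem tv_e1 (n l a c : ℕ) (hn : 2 ≤ n) :
    eC n l 1 (tripleVec n a (c+1) 0) = some (tripleVec n (a+1) c 0) := by
  have h1 : 1 < n := by omega
  have h2 : ¬ 1 = n := by omega
  have h3 : ¬ (1 = 0) := by omega
  simp only [eC, h1, h2, h3, if_true, if_false, tv_x1 _ _ _ _ hn, tv_x2 _ _ _ _ hn,
    tv_y _ _ _ _ 2 le_rfl, Nat.reduceAdd]
  rw [if_pos (by omega)]
  congr 1
  apply Prod.ext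
  · funext t; simp only [setx, tripleVec]; split_ifs <;> omega
  · rfl

theorem tv_e0' (n l a d : ℕ) (hn : 2 ≤ n) (had : a = 0 ∨ d = 0) (c : Tup n)
    (h : eC n l 0 (tripleVec n a 0 d) = some c) :
    ∃ a' d', c = tripleVec n a' 0 d' ∧ (a' = 0 ∨ d' = 0) := by
  have h0 : 0 < n := by omega
  simp only [eC, if_true, h0, tv_x1 _ _ _ _ hn, tv_y1 _ _ _ _ hn] at h
  split_ifs at h with h1 h2 h3
  · refine ⟨a - 2, d, ?_, by omega⟩
    rw [← Option.some.inj h]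
    apply Prod.ext
    · funext t; simp only [setx, tripleVec]; split_ifs <;> omega
    · rfl
  · refine ⟨a - 1, d + 1, ?_, by omega⟩
    rw [← Option.some.inj h]
    apply Prod.ext
    · funext t; simp only [setx, tripleVec]; split_ifs <;> omega
    · funext t; simp only [setx, tripleVec]; split_ifs <;> omega
  · refine ⟨a, d + 2, ?_, by omega⟩
    rw [← Option.some.inj h]
    apply Prod.ext
    · rfl
    · funext t; simp only [setx, tripleVec]; split_ifs <;> omega

theorem hw_form (n l : ℕ) (hn : 2 ≤ n) (b : Tup n) (h : ∀ i, 1 ≤ i → i ≤ n → ep n l i b = 0) :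
    b = tripleVec n (xc b 1) 0 0 := by
  have hy : ∀ i, 1 ≤ i → i ≤ n → xbc b i = 0 := by
    intro i h1 h2
    have := h i h1 h2
    have h0 : ¬ i = 0 := by omega
    simp only [ep, h0, if_false] at this
    split_ifs at this with hh
    · rw [hh]; exact this
    · omega
  have hx : ∀ i, 2 ≤ i → i ≤ n → xc b i = 0 := by
    intro i h1 h2
    have h3 := h (i - 1) (by omega) (by omega)
    have h0 : ¬ i - 1 = 0 := by omega
    have h4 : ¬ i - 1 = n := by omega
    have h5 : i - 1 + 1 = i := by omega
    simp only [ep, h0, h4, h5, if_false] at h3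
    have := hy i (by omega) h2
    omega
  apply tup_ext
  · intro i h1 h2
    by_cases e1 : i = 1
    · subst e1; rw [tv_x1 _ _ _ _ hn]
    rw [hx i (by omega) h2]
    by_cases e2 : i = 2
    · subst e2; rw [tv_x2 _ _ _ _ hn]
    rw [tv_x _ _ _ _ _ (by omega)]
  · intro i h1 h2
    rw [hy i h1 h2]
    by_cases e1 : i = 1
    · subst e1; rw [tv_y1 _ _ _ _ hn]
    rw [tv_y _ _ _ _ _ (by omega)]

section conn
variable (n l k : ℕ) (Q : Tup n × Tup n → Prop)

theorem conn5 (hn : 2 ≤ n) (hQ : ∀ b1 b2, memC n l b1 → memC n k b2 → ∀ i ≤ n, ∀ v,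
      eTenC n l k i (b1, b2) = some v → (Q (b1, b2) ↔ Q v)) :
    ∀ N a, k = a + 2 * N →
    (Q (tripleVec n l 0 0, tripleVec n a 0 0) ↔
      Q (tripleVec n l 0 0, tripleVec n k 0 0)) := by
  intro N
  induction N with
  | zero => intro a ha; obtain rfl : k = a := by omega
            rfl
  | succ N ih =>
    intro a ha
    rw [← ih (a + 2) (by omega)]
    have m1 : memC n l (tripleVec n l 0 0) := tv_mem _ _ _ _ _ hn (by omega) (by simp)
    have m2 : memC n k (tripleVec n (a+2) 0 0) := tv_mem _ _ _ _ _ hn (by omega) (by omega)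
    refine (hQ _ _ m1 m2 0 (by omega) _ ?_).symm
    rw [eTen_eq n l k 0 hn (by omega) _ _ m1 m2, tv_ep0 _ _ _ _ _ hn, tv_ph0 _ _ _ _ _ hn,
      if_neg (by omega), tv_e0 _ _ _ _ hn]
    rfl

theorem conn4 (hn : 2 ≤ n) (hQ : ∀ b1 b2, memC n l b1 → memC n k b2 → ∀ i ≤ n, ∀ v,
      eTenC n l k i (b1, b2) = some v → (Q (b1, b2) ↔ Q v)) :
    ∀ N b1 a, Mw n b1 = N → tsum b1 = l → memC n k (tripleVec n a 0 0) →
    (Q (b1, tripleVec n a 0 0) ↔ Q (tripleVec n l 0 0, tripleVec n k 0 0)) := by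
  intro N
  induction N using Nat.strong_induction_on with
  | _ N ih =>
    intro b1 a hN hl hm
    have m1 : memC n l b1 := by simp [memC, hl]
    by_cases h : ∀ i, 1 ≤ i → i ≤ n → ep n l i b1 = 0
    · have hf := hw_form n l hn b1 h
      rw [hf, tv_tsum _ _ _ _ hn] at hl
      have hl : xc b1 1 = l := by omega
      rw [hl] at hf
      rw [hf]
      simp only [memC, tv_tsum _ _ _ _ hn] at hm
      exact conn5 n l k Q hn hQ ((k - a) / 2) a (by omega)
    · push Not at h
      obtain ⟨i, h1, h2, h3⟩ := h
      rcases e_spec n l i hn h2 b1 m1 with h | ⟨c, e1, e2, _, _, _, e3⟩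
      · exact absurd h.1 h3
      · obtain ⟨e4, e5⟩ := e3 h1
        rw [hQ b1 _ m1 hm i h2 (c, tripleVec n a 0 0)]
        · exact ih _ (by omega) c a rfl (by omega) hm
        · rw [eTen_eq n l k i hn h2 _ _ m1 hm, tv_ep _ _ _ _ h1, if_pos (by omega), e1]; rfl

theorem conn3 (hn : 2 ≤ n) (hQ : ∀ b1 b2, memC n l b1 → memC n k b2 → ∀ i ≤ n, ∀ v,
      eTenC n l k i (b1, b2) = some v → (Q (b1, b2) ↔ Q v)) :
    ∀ N b2, Mw n b2 = N → memC n k b2 →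
    (Q (tripleVec n 0 0 l, b2) ↔ Q (tripleVec n l 0 0, tripleVec n k 0 0)) := by
  intro N
  induction N using Nat.strong_induction_on with
  | _ N ih =>
    intro b2 hN hm
    have m1 : memC n l (tripleVec n 0 0 l) := tv_mem _ _ _ _ _ hn (by omega) (by simp)
    by_cases h : ∀ i, 1 ≤ i → i ≤ n → ep n k i b2 = 0
    · have hf := hw_form n k hn b2 h
      rw [hf] at hm ⊢
      exact conn4 n l k Q hn hQ _ _ _ rfl (by rw [tv_tsum _ _ _ _ hn]; omega) hm
    · push Not at h
      obtain ⟨i, h1, h2, h3⟩ := h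
      rcases e_spec n k i hn h2 b2 hm with h | ⟨c, e1, e2, _, _, _, e3⟩
      · exact absurd h.1 h3
      · obtain ⟨e4, e5⟩ := e3 h1
        rw [hQ _ b2 m1 hm i h2 (tripleVec n 0 0 l, c)]
        · exact ih _ (by omega) c rfl e2
        · rw [eTen_eq n l k i hn h2 _ _ m1 hm, tv_ph _ _ _ _ h1, if_neg (by omega), e1]; rfl

theorem conn2 (hn : 2 ≤ n) (hQ : ∀ b1 b2, memC n l b1 → memC n k b2 → ∀ i ≤ n, ∀ v,
      eTenC n l k i (b1, b2) = some v → (Q (b1, b2) ↔ Q v)) :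
    ∀ N a d b2, (a = 0 ∨ d = 0) → memC n l (tripleVec n a 0 d) → memC n k b2 →
    tE n l k 0 (tripleVec n a 0 d, b2) = N →
    (Q (tripleVec n a 0 d, b2) ↔ Q (tripleVec n l 0 0, tripleVec n k 0 0)) := by
  intro N
  induction N with
  | zero =>
    intro a d b2 had m1 m2 hE
    have : ep n l 0 (tripleVec n a 0 d) = 0 := by simp only [tE] at hE; omega
    rw [tv_ep0 _ _ _ _ _ hn] at this
    have m1' := m1
    simp only [memC, tv_tsum _ _ _ _ hn] at m1'
    obtain rfl : a = 0 := by omega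
    obtain rfl : d = l := by omega
    exact conn3 n d k Q hn hQ _ b2 rfl m2
  | succ N ih =>
    intro a d b2 had m1 m2 hE
    rcases eTen_spec n l k 0 hn (by omega) _ _ m1 m2 with h | ⟨v, h1, h2, h3, h4, h5, h6⟩
    · omega
    · rw [hQ _ _ m1 m2 0 (by omega) v h1]
      obtain ⟨a', d', hv, had'⟩ : ∃ a' d', v.1 = tripleVec n a' 0 d' ∧ (a' = 0 ∨ d' = 0) := by
        rw [eTen_eq n l k 0 hn (by omega) _ _ m1 m2] at h1
        split_ifs at h1
        · rw [Option.map_eq_some_iff] at h1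
          obtain ⟨c, hc, rfl⟩ := h1
          exact tv_e0' n l a d hn had c hc
        · rw [Option.map_eq_some_iff] at h1
          obtain ⟨c, hc, rfl⟩ := h1
          exact ⟨a, d, rfl, had⟩
      obtain ⟨v1, v2⟩ := v
      simp only at hv h2 h3
      subst hv
      exact ih a' d' v2 had' h2 h3 (by omega)

theorem conn1 (hn : 2 ≤ n) (hQ : ∀ b1 b2, memC n l b1 → memC n k b2 → ∀ i ≤ n, ∀ v,
      eTenC n l k i (b1, b2) = some v → (Q (b1, b2) ↔ Q v)) :
    ∀ N b1 b2, Mw n b1 + Mw n b2 = N → memC n l b1 → memC n k b2 →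
    (Q (b1, b2) ↔ Q (tripleVec n l 0 0, tripleVec n k 0 0)) := by
  intro N
  induction N using Nat.strong_induction_on with
  | _ N ih =>
    intro b1 b2 hN m1 m2
    by_cases h : ∀ i, 1 ≤ i → i ≤ n → ep n l i b1 = 0
    · have hf := hw_form n l hn b1 h
      rw [hf] at m1 ⊢
      exact conn2 n l k Q hn hQ _ _ _ b2 (Or.inr rfl) m1 m2 rfl
    · push Not at h
      obtain ⟨i, h1, h2, h3⟩ := h
      rcases eTen_spec n l k i hn h2 _ _ m1 m2 with h | ⟨v, e1, e2, e3, _, _, e6⟩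
      · have := h.1; simp only [tE] at this; omega
      · rw [hQ b1 _ m1 m2 i h2 v e1]
        have := e6 h1
        exact ih _ (by omega) v.1 v.2 rfl e2 e3
end conn

theorem base_arith (l k m x1 y1 x2 y2 z1 w1 z2 w2 s t : ℕ) (hl : m ≤ l) (hk : m ≤ k)
    (h1 : s ≤ k) (h2 : (k - s) % 2 = 0) (h3 : t ≤ l) (h4 : (l - t) % 2 = 0)
    (g1 : x1 + x2 ≤ s) (g2 : z1 + z2 ≤ t)
    (E0 : (k - s) / 2 + (x1 - y1) + ((l - t) / 2 + (z1 - w1) - ((k - s) / 2 + (y1 - x1))) = m)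
    (F0 : (l - t) / 2 + (w1 - z1) + ((k - s) / 2 + (y1 - x1) - ((l - t) / 2 + (z1 - w1))) = 0)
    (E1 : y1 + (x2 - y2) + (w1 + (z2 - w2) - (x1 + (y2 - x2))) = (l - m) + (k - m))
    (F1 : z1 + (w2 - z2) + (x1 + (y2 - x2) - (w1 + (z2 - w2))) = 0) :
    z1 = 0 ∧ s ≤ x1 + x2 ∧ t ≤ z1 + z2 ∧ x1 = m ∧ x2 = k - m ∧ z2 = l := by
  obtain rfl : z1 = 0 := by clear E0 F0 E1 hl hk; omega
  obtain rfl : w1 = 0 := by clear E0 F1 E1 hl hk; omega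
  have f1 : (l - t) / 2 = 0 := by clear E0 F1 E1 hl hk; omega
  obtain rfl : t = l := by clear E0 F1 E1 F0; omega
  have f2 : (k - s) / 2 = 0 := by clear E0 F1 E1 f1 hl; omega
  obtain rfl : s = k := by clear E0 F1 E1 F0; omega
  simp only [Nat.sub_self, Nat.zero_div, Nat.zero_add, Nat.add_zero, Nat.sub_zero] at *
  have f3 : y1 ≤ x1 := by omega
  have f4 : x1 = y1 + m := by omega
  subst f4
  clear E0 F0 f1 f2 f3 h1 h2 h3 h4
  have e1 : w2 ≤ z2 := by omega
  have e2 : y1 + m + (y2 - x2) ≤ z2 - w2 := by omega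
  have e3 : x2 + z2 + m = t + s + y2 + w2 := by omega
  refine ⟨trivial, ?_, ?_, ?_, ?_, ?_⟩ <;> omega

theorem base_iota {n l k : ℕ} (hn : 2 ≤ n) {ι : Tup n × Tup n → Tup n × Tup n}
    (hι : IsIsoC n l k ι) :
    ι (tripleVec n (min l k) (l - min l k) 0, tripleVec n 0 k 0) =
      (tripleVec n (min l k) (k - min l k) 0, tripleVec n 0 l 0) := by
  obtain ⟨m, hm⟩ : ∃ m, m = min l k := ⟨_, rfl⟩
  rw [← hm]
  have hm1 : m ≤ l := by omega
  have hm2 : m ≤ k := by omega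
  have m1 : memC n l (tripleVec n m (l - m) 0) := tv_mem _ _ _ _ _ hn (by omega) (by omega)
  have m2 : memC n k (tripleVec n 0 k 0) := tv_mem _ _ _ _ _ hn (by omega) (by omega)
  have mi := iso_mem hι (tripleVec n m (l - m) 0, tripleVec n 0 k 0) m1 m2
  have E0 := iso_tE hι hn 0 (by omega) _ (tripleVec n m (l - m) 0, tripleVec n 0 k 0) m1 m2 rfl
  have F0 := iso_tF hι hn 0 (by omega) _ (tripleVec n m (l - m) 0, tripleVec n 0 k 0) m1 m2 rfl
  have E1 := iso_tE hι hn 1 (by omega) _ (tripleVec n m (l - m) 0, tripleVec n 0 k 0) m1 m2 rfl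
  have F1 := iso_tF hι hn 1 (by omega) _ (tripleVec n m (l - m) 0, tripleVec n 0 k 0) m1 m2 rfl
  generalize ι (tripleVec n m (l - m) 0, tripleVec n 0 k 0) = w at *
  obtain ⟨c1, c2⟩ := w
  have n1 : ¬ 1 = n := by omega
  simp only [tE, tF, tv_ep0 _ _ _ _ _ hn, tv_ph0 _ _ _ _ _ hn, tv_ep1 _ _ _ _ _ hn,
    tv_ph1 _ _ _ _ _ hn] at E0 F0 E1 F1
  simp only [ep, ph, if_true, n1, if_false, one_ne_zero, Nat.reduceAdd] at E0 F0 E1 F1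
  simp only [memC] at mi
  have t1 := tsum12 hn c1
  have t2 := tsum12 hn c2
  clear m1 m2 hι
  obtain ⟨g1, g1'⟩ := t1
  obtain ⟨g2, g2'⟩ := t2
  have ar := base_arith l k m (xc c1 1) (xbc c1 1) (xc c1 2) (xbc c1 2) (xc c2 1) (xbc c2 1)
    (xc c2 2) (xbc c2 2) (tsum c1) (tsum c2) hm1 hm2 mi.1.1 mi.1.2 mi.2.1 mi.2.2 g1 g2
    (E0.trans (by clear E0 F0 E1 F1 mi; omega)) (F0.trans (by clear E0 F0 E1 F1 mi; omega)) (E1.trans (by clear E0 F0 E1 F1 mi; omega)) (F1.trans (by clear E0 F0 E1 F1 mi; omega))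
  have r1 := g1' ar.2.1
  have r2 := g2' ar.2.2.1
  obtain ⟨z, -, -, a1, a2, a3⟩ := ar
  rw [r1, r2, z, a1, a2, a3]

theorem base_H {n l k : ℕ} (hn : 2 ≤ n) {ι : Tup n × Tup n → Tup n × Tup n}
    {H : Tup n × Tup n → ℤ} (hH : IsEnergyC n l k ι H) :
    H (tripleVec n (min l k) (l - min l k) 0, tripleVec n 0 k 0) = 0 := by
  have key : ∀ j a, a + j = l → min l k ≤ a →
      H (tripleVec n a j 0, tripleVec n 0 k 0) = 0 := by
    intro j
    induction j with
    | zero =>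
      intro a ha _
      obtain rfl : a = l := by omega
      have := hH.2
      rwa [uvec_tv, u2vec_tv] at this
    | succ j ih =>
      intro a ha hm
      have m1 : memC n l (tripleVec n a (j+1) 0) := tv_mem _ _ _ _ _ hn (by omega) (by omega)
      have m2 : memC n k (tripleVec n 0 k 0) := tv_mem _ _ _ _ _ hn (by omega) (by omega)
      have := hH.1 (tripleVec n a (j+1) 0, tripleVec n 0 k 0) ⟨m1, m2⟩ 1 (by omega) (tripleVec n (a+1) j 0, tripleVec n 0 k 0) (by
        rw [eTen_eq n l k 1 hn (by omega) _ _ m1 m2, tv_ep1 _ _ _ _ _ hn, tv_ph1 _ _ _ _ _ hn,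
          if_pos (by omega), tv_e1 _ _ _ _ hn]
        rfl)
      rw [ih (a+1) (by omega) (by omega)] at this
      simpa using this.symm
  exact key _ _ (by omega) le_rfl

/-- the four-step path from the base point to the reduced base point -/
theorem path {n l k m : ℕ} (hn : 2 ≤ n) (h2 : 2 ≤ m) (hl : m ≤ l) (hk : m ≤ k) :
    eTenC n l k 0 (tripleVec n m (l - m) 0, tripleVec n 0 k 0) =
      some (tripleVec n (m - 2) (l - m) 0, tripleVec n 0 k 0) ∧
    eTenC n l k 1 (tripleVec n (m - 2) (l - m) 0, tripleVec n 0 k 0) =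
      some (tripleVec n (m - 2) (l - m) 0, tripleVec n 1 (k - 1) 0) ∧
    eTenC n l k 1 (tripleVec n (m - 2) (l - m) 0, tripleVec n 1 (k - 1) 0) =
      some (tripleVec n (m - 2) (l - m) 0, tripleVec n 2 (k - 2) 0) ∧
    eTenC n l k 0 (tripleVec n (m - 2) (l - m) 0, tripleVec n 2 (k - 2) 0) =
      some (tripleVec n (m - 2) (l - m) 0, tripleVec n 0 (k - 2) 0) := by
  have m1 : memC n l (tripleVec n m (l - m) 0) := tv_mem _ _ _ _ _ hn (by omega) (by omega)
  have m1' : memC n l (tripleVec n (m-2) (l - m) 0) := tv_mem _ _ _ _ _ hn (by omega) (by omega)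
  have m2 : memC n k (tripleVec n 0 k 0) := tv_mem _ _ _ _ _ hn (by omega) (by omega)
  have m3 : memC n k (tripleVec n 1 (k - 1) 0) := tv_mem _ _ _ _ _ hn (by omega) (by omega)
  have m4 : memC n k (tripleVec n 2 (k - 2) 0) := tv_mem _ _ _ _ _ hn (by omega) (by omega)
  refine ⟨?_, ?_, ?_, ?_⟩
  · rw [eTen_eq n l k 0 hn (by omega) _ _ m1 m2, tv_ep0 _ _ _ _ _ hn, tv_ph0 _ _ _ _ _ hn,
      if_pos (by omega)]
    have := tv_e0 n l (m - 2) (l - m) hn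
    rw [Nat.sub_add_cancel h2] at this
    rw [this]; rfl
  · rw [eTen_eq n l k 1 hn (by omega) _ _ m1' m2, tv_ep1 _ _ _ _ _ hn, tv_ph1 _ _ _ _ _ hn,
      if_neg (by omega)]
    have := tv_e1 n k 0 (k - 1) hn
    rw [Nat.sub_add_cancel (by omega)] at this
    rw [this]; rfl
  · rw [eTen_eq n l k 1 hn (by omega) _ _ m1' m3, tv_ep1 _ _ _ _ _ hn, tv_ph1 _ _ _ _ _ hn,
      if_neg (by omega)]
    have := tv_e1 n k 1 (k - 2) hn
    rw [show k - 2 + 1 = k - 1 by omega] at this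
    rw [this]; rfl
  · rw [eTen_eq n l k 0 hn (by omega) _ _ m1' m4, tv_ep0 _ _ _ _ _ hn, tv_ph0 _ _ _ _ _ hn,
      if_neg (by omega), tv_e0 n k 0 (k - 2) hn]
    rfl

theorem iso_step {n l k : ℕ} {ι : Tup n × Tup n → Tup n × Tup n} (hι : IsIsoC n l k ι)
    {u v w : Tup n × Tup n} (h1 : memC n l u.1) (h2 : memC n k u.2) {i : ℕ} (hi : i ≤ n)
    (h : eTenC n l k i u = some v) (h' : eTenC n k l i (ι u) = some w) : ι v = w := by
  have := (hι.2 u ⟨h1, h2⟩ i hi).1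
  rw [h, h'] at this
  simpa using this

theorem base_red {n l k m : ℕ} (hn : 2 ≤ n) (h2 : 2 ≤ m) (hm : m = min l k)
    {ι : Tup n × Tup n → Tup n × Tup n}
    (hι : IsIsoC n l k ι) {H : Tup n × Tup n → ℤ} (hH : IsEnergyC n l k ι H) :
    ι (tripleVec n (m - 2) (l - m) 0, tripleVec n 0 (k - 2) 0) =
      (tripleVec n (m - 2) (k - m) 0, tripleVec n 0 (l - 2) 0) ∧
    H (tripleVec n (m - 2) (l - m) 0, tripleVec n 0 (k - 2) 0) = 0 := by
  have hl : m ≤ l := by omega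
  have hk : m ≤ k := by omega
  have m1 : memC n l (tripleVec n m (l - m) 0) := tv_mem _ _ _ _ _ hn (by omega) (by omega)
  have m1' : memC n l (tripleVec n (m-2) (l - m) 0) := tv_mem _ _ _ _ _ hn (by omega) (by omega)
  have m2 : memC n k (tripleVec n 0 k 0) := tv_mem _ _ _ _ _ hn (by omega) (by omega)
  have m3 : memC n k (tripleVec n 1 (k - 1) 0) := tv_mem _ _ _ _ _ hn (by omega) (by omega)
  have m4 : memC n k (tripleVec n 2 (k - 2) 0) := tv_mem _ _ _ _ _ hn (by omega) (by omega)
  have p1 : memC n k (tripleVec n m (k - m) 0) := tv_mem _ _ _ _ _ hn (by omega) (by omega)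
  have p1' : memC n k (tripleVec n (m-2) (k - m) 0) := tv_mem _ _ _ _ _ hn (by omega) (by omega)
  have p2 : memC n l (tripleVec n 0 l 0) := tv_mem _ _ _ _ _ hn (by omega) (by omega)
  have p4 : memC n l (tripleVec n 2 (l - 2) 0) := tv_mem _ _ _ _ _ hn (by omega) (by omega)
  obtain ⟨a1, a2, a3, a4⟩ := path hn h2 hl hk
  obtain ⟨c1, c2, c3, c4⟩ := path hn h2 hk hl
  have i0 := base_iota hn hι
  have H0 := base_H hn hH
  rw [← hm] at i0 H0
  have i1 := iso_step hι m1 m2 (by omega) a1 (by rw [i0]; exact c1)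
  have i2 := iso_step hι m1' m2 (by omega) a2 (by rw [i1]; exact c2)
  have i3 := iso_step hι m1' m3 (by omega) a3 (by rw [i2]; exact c3)
  have i4 := iso_step hι m1' m4 (by omega) a4 (by rw [i3]; exact c4)
  refine ⟨i4, ?_⟩
  have H1 := hH.1 (tripleVec n m (l - m) 0, tripleVec n 0 k 0) ⟨m1, m2⟩ 0 (by omega) _ a1
  have H2 := hH.1 (tripleVec n (m - 2) (l - m) 0, tripleVec n 0 k 0) ⟨m1', m2⟩ 1 (by omega) _ a2
  have H3 := hH.1 (tripleVec n (m - 2) (l - m) 0, tripleVec n 1 (k - 1) 0) ⟨m1', m3⟩ 1 (by omega) _ a3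
  have H4 := hH.1 (tripleVec n (m - 2) (l - m) 0, tripleVec n 2 (k - 2) 0) ⟨m1', m4⟩ 0 (by omega) _ a4
  rw [i0] at H1
  rw [i3] at H4
  simp only [epsC_eq n _ 0 hn (by omega) _ m2, phiC_eq n _ 0 hn (by omega) _ m1,
    epsC_eq n _ 0 hn (by omega) _ p2, phiC_eq n _ 0 hn (by omega) _ p1,
    tv_ep0 _ _ _ _ _ hn, tv_ph0 _ _ _ _ _ hn] at H1
  simp only [epsC_eq n _ 0 hn (by omega) _ m4, phiC_eq n _ 0 hn (by omega) _ m1',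
    epsC_eq n _ 0 hn (by omega) _ p4, phiC_eq n _ 0 hn (by omega) _ p1',
    tv_ep0 _ _ _ _ _ hn, tv_ph0 _ _ _ _ _ hn] at H4
  rw [if_pos trivial, if_pos (by omega)] at H1
  rw [if_pos trivial, if_neg (by omega), if_pos (by omega)] at H4
  rw [if_neg one_ne_zero] at H2 H3
  omega

/-! extension from `B_{l}` to `B_{l+2}` -/

theorem mem_ext {n l : ℕ} {b : Tup n} (h : memC n l b) : memC n (l+2) b := by
  simp only [memC] at *; omega

theorem ep_ext {n l : ℕ} {b : Tup n} (h : memC n l b) (i : ℕ) :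
    ep n (l+2) i b = ep n l i b + (if i = 0 then 1 else 0) := by
  simp only [memC] at h
  simp only [ep]; split_ifs <;> omega

theorem ph_ext {n l : ℕ} {b : Tup n} (h : memC n l b) (i : ℕ) :
    ph n (l+2) i b = ph n l i b + (if i = 0 then 1 else 0) := by
  simp only [memC] at h
  simp only [ph]; split_ifs <;> omega

theorem eC_ext {n l i : ℕ} {b c : Tup n} (h : eC n l i b = some c) : eC n (l+2) i b = some c := by
  by_cases hi : i = 0
  · subst hi
    simp only [eC, if_true] at h ⊢
    split_ifs at h ⊢ <;> first | exact h | omega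
  · simpa only [eC, hi, if_false] using h

theorem fC_ext {n l i : ℕ} {b c : Tup n} (h : fC n l i b = some c) : fC n (l+2) i b = some c := by
  by_cases hi : i = 0
  · subst hi
    simp only [fC, if_true] at h ⊢
    split_ifs at h ⊢ <;> first | exact h | omega
  · simpa only [fC, hi, if_false] using h

theorem eTen_ext {n l k i : ℕ} (hn : 2 ≤ n) (hi : i ≤ n) {u v : Tup n × Tup n}
    (m1 : memC n l u.1) (m2 : memC n k u.2)
    (h : eTenC n l k i u = some v) : eTenC n (l+2) (k+2) i u = some v := by
  obtain ⟨b1, b2⟩ := u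
  rw [eTen_eq n _ _ i hn hi _ _ (mem_ext m1) (mem_ext m2), ep_ext m2, ph_ext m1]
  rw [eTen_eq n _ _ i hn hi _ _ m1 m2] at h
  simp only [Nat.add_le_add_iff_right]
  split_ifs at h ⊢
  all_goals
    rw [Option.map_eq_some_iff] at h
    obtain ⟨c, hc, rfl⟩ := h
    rw [eC_ext hc]; rfl

theorem fTen_ext {n l k i : ℕ} (hn : 2 ≤ n) (hi : i ≤ n) {u v : Tup n × Tup n}
    (m1 : memC n l u.1) (m2 : memC n k u.2)
    (h : fTenC n l k i u = some v) : fTenC n (l+2) (k+2) i u = some v := by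
  obtain ⟨b1, b2⟩ := u
  rw [fTen_eq n _ _ i hn hi _ _ (mem_ext m1) (mem_ext m2), ep_ext m2, ph_ext m1]
  rw [fTen_eq n _ _ i hn hi _ _ m1 m2] at h
  simp only [Nat.add_lt_add_iff_right]
  split_ifs at h ⊢
  all_goals
    rw [Option.map_eq_some_iff] at h
    obtain ⟨c, hc, rfl⟩ := h
    rw [fC_ext hc]; rfl

theorem main_step {n l k : ℕ} (hn : 2 ≤ n)
    {ι : Tup n × Tup n → Tup n × Tup n} (hι : IsIsoC n (l+2) (k+2) ι)
    {ι' : Tup n × Tup n → Tup n × Tup n} (hι' : IsIsoC n l k ι')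
    {H : Tup n × Tup n → ℤ} (hH : IsEnergyC n (l+2) (k+2) ι H)
    {H' : Tup n × Tup n → ℤ} (hH' : IsEnergyC n l k ι' H')
    (b1 b2 : Tup n) (m1 : memC n l b1) (m2 : memC n k b2) (i : ℕ) (hi : i ≤ n)
    (v : Tup n × Tup n) (hv : eTenC n l k i (b1, b2) = some v) :
    ((ι (b1, b2) = ι' (b1, b2) ∧ H (b1, b2) = H' (b1, b2)) ↔ (ι v = ι' v ∧ H v = H' v)) := by
  have M1 := mem_ext m1
  have M2 := mem_ext m2
  have hv2 := eTen_ext (u := (b1, b2)) hn hi m1 m2 hv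
  have mi := iso_mem hι' (b1, b2) m1 m2
  have e' := (hι'.2 (b1, b2) ⟨m1, m2⟩ i hi).1
  rw [hv] at e'
  have e := (hι.2 (b1, b2) ⟨M1, M2⟩ i hi).1
  rw [hv2] at e
  simp only [Option.map_some] at e e'
  have x' := eTen_ext hn hi mi.1 mi.2 e'.symm
  obtain ⟨mv1, mv2, hf⟩ : memC n l v.1 ∧ memC n k v.2 ∧ fTenC n l k i v = some (b1, b2) := by
    rcases eTen_spec n l k i hn hi b1 b2 m1 m2 with h | ⟨v', h1, h2, h3, h4, h5, h6⟩
    · rw [h.2] at hv; simp at hv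
    · rw [h1] at hv
      obtain rfl := Option.some.inj hv
      exact ⟨h2, h3, h5⟩
  have hf2 := fTen_ext hn hi mv1 mv2 hf
  have miv := iso_mem hι' v mv1 mv2
  have g' := (hι'.2 v ⟨mv1, mv2⟩ i hi).2
  rw [hf] at g'
  have g := (hι.2 v ⟨mem_ext mv1, mem_ext mv2⟩ i hi).2
  rw [hf2] at g
  simp only [Option.map_some] at g g'
  have y' := fTen_ext hn hi miv.1 miv.2 g'.symm
  have hiff : ι (b1, b2) = ι' (b1, b2) ↔ ι v = ι' v := by
    constructor
    · intro h
      rw [h, x'] at e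
      exact Option.some.inj e
    · intro h
      rw [h, y'] at g
      exact Option.some.inj g
  have hh := hH.1 (b1, b2) ⟨M1, M2⟩ i hi v hv2
  have hh' := hH'.1 (b1, b2) ⟨m1, m2⟩ i hi v hv
  have key : ι (b1, b2) = ι' (b1, b2) → H v - H (b1, b2) = H' v - H' (b1, b2) := by
    intro h
    rw [h] at hh
    simp only [epsC_eq n _ 0 hn (by omega) _ m2, phiC_eq n _ 0 hn (by omega) _ m1,
      epsC_eq n _ 0 hn (by omega) _ mi.2, phiC_eq n _ 0 hn (by omega) _ mi.1] at hh'
    simp only [epsC_eq n _ 0 hn (by omega) _ M2, phiC_eq n _ 0 hn (by omega) _ M1,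
      epsC_eq n _ 0 hn (by omega) _ (mem_ext mi.2), phiC_eq n _ 0 hn (by omega) _ (mem_ext mi.1),
      ep_ext m2, ph_ext m1, ep_ext mi.2, ph_ext mi.1, if_true, Nat.add_le_add_iff_right,
      Nat.add_lt_add_iff_right] at hh
    omega
  constructor
  · rintro ⟨h1, h2⟩
    have := key h1
    exact ⟨hiff.1 h1, by omega⟩
  · rintro ⟨h1, h2⟩
    have := key (hiff.2 h1)
    exact ⟨hiff.2 h1, by omega⟩

/-- **Lemma 4.6.**  For `b ∈ B_{l-2}`, the map `τ^l_{l-2}` adds a `(0,0̄)` pair, i.e. it is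
the identity on the underlying tuples, regarded as a map `B_{l-2} → B_l`.  The
combinatorial `R` on `B_l ⊗ B_k` restricted along `τ^l_{l-2} ⊗ τ^k_{k-2}` agrees with the
combinatorial `R` on `B_{l-2} ⊗ B_{k-2}`, and the energies agree. -/
theorem lemma_4_6
    (n l k : ℕ) (hn : 2 ≤ n) (hl : 3 ≤ l) (hk : 3 ≤ k)
    (ι : Tup n × Tup n → Tup n × Tup n) (hι : IsIsoC n l k ι)
    (ι' : Tup n × Tup n → Tup n × Tup n) (hι' : IsIsoC n (l - 2) (k - 2) ι')
    (H : Tup n × Tup n → ℤ) (hH : IsEnergyC n l k ι H)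
    (H' : Tup n × Tup n → ℤ) (hH' : IsEnergyC n (l - 2) (k - 2) ι' H')
    (b1 b2 : Tup n) (hb1 : b1 ∈ BC n (l - 2)) (hb2 : b2 ∈ BC n (k - 2))
    (b1' b2' : Tup n) (hval : ι' (b1, b2) = (b2', b1')) :
    ι (b1, b2) = (b2', b1') ∧ H (b1, b2) = H' (b1, b2) := by
  obtain ⟨l, rfl⟩ : ∃ l', l = l' + 2 := ⟨l - 2, by omega⟩
  obtain ⟨k, rfl⟩ : ∃ k', k = k' + 2 := ⟨k - 2, by omega⟩
  simp only [Nat.add_sub_cancel] at hι' hH' hb1 hb2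
  have step := main_step hn hι hι' hH hH'
  have c := conn1 n l k (fun u => ι u = ι' u ∧ H u = H' u) hn step
  have hred := base_red hn (m := min l k + 2) (by omega) (by omega) hι hH
  rw [Nat.add_sub_cancel, Nat.add_sub_cancel, Nat.add_sub_cancel, Nat.add_sub_add_right,
    Nat.add_sub_add_right] at hred
  have i' := base_iota hn hι'
  have h' := base_H hn hH'
  have m1 : memC n l (tripleVec n (min l k) (l - min l k) 0) :=
    tv_mem _ _ _ _ _ hn (by omega) (by omega)
  have m2 : memC n k (tripleVec n 0 k 0) := tv_mem _ _ _ _ _ hn (by omega) (by omega)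
  have r := (c _ b1 b2 rfl hb1 hb2).2 ((c _ _ _ rfl m1 m2).1
    ⟨by rw [i', hred.1], by rw [h', hred.2]⟩)
  exact ⟨by rw [r.1, hval], r.2⟩
end KTT
end

section
/- Compatibility of τ with the crystal operators: Let n ≥ 2 and l ≥ 3. For b ∈ B_{l−2}, let τ^l_{l−2}(b) ∈ B_l denote the same 2n-tuple regarded as an element of B_l (so x_0 increases by 1). Then for all 0 ≤ i ≤ n and b ∈ B_{l−2}: if f̃_i b ≠ 0 then f̃_i(τ^l_{l−2}(b)) = τ^l_{l−2}(f̃_i b); if ẽ_i b ≠ 0 then ẽ_i(τ^l_{l−2}(b)) = τ^l_{l−2}(ẽ_i b); moreover φ_i(τ^l_{l−2}(b)) = φ_i(b) + δ_{i,0} and ε_i(τ^l_{l−2}(b)) = ε_i(b) + δ_{i,0}, where δ_{i,0} = 1 if i = 0 and 0 otherwise. -/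
namespace KTT

theorem iter_none {α : Type*} (g : α → Option α) (m : ℕ) :
    (fun o => Option.bind o g)^[m] none = none := by
  induction m with
  | zero => rfl
  | succ k ih => rw [Function.iterate_succ_apply]; exact ih

theorem iter_ne_none_iff {α : Type*} (g : α → Option α) (P : α → Prop) (r : α → ℕ)
    (h0 : ∀ b, P b → g b = none → r b = 0)
    (h1 : ∀ b, P b → ∀ c, g b = some c → P c ∧ r b = r c + 1) (m : ℕ) :
    ∀ b, P b → ((fun o => Option.bind o g)^[m] (some b) ≠ none ↔ m ≤ r b) := by
  induction m with
  | zero => intro b _; simp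
  | succ k ih =>
    intro b hb
    rw [Function.iterate_succ_apply]
    change (fun o => Option.bind o g)^[k] (g b) ≠ none ↔ _
    rcases hg : g b with _ | c
    · have := h0 b hb hg
      rw [iter_none]
      simp; omega
    · obtain ⟨hc, hr⟩ := h1 b hb c hg
      rw [ih c hc]; omega

theorem iter_sSup {α : Type*} (g : α → Option α) (P : α → Prop) (r : α → ℕ)
    (h0 : ∀ b, P b → g b = none → r b = 0)
    (h1 : ∀ b, P b → ∀ c, g b = some c → P c ∧ r b = r c + 1) (b : α) (hb : P b) :
    sSup {m | (fun o => Option.bind o g)^[m] (some b) ≠ none} = r b := by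
  have : {m | (fun o => Option.bind o g)^[m] (some b) ≠ none} = Set.Iic (r b) := by
    ext m
    exact iter_ne_none_iff g P r h0 h1 m b hb
  rw [this, csSup_Iic]

theorem sum_setx {n : ℕ} (hn : 0 < n) (f : Fin n → ℕ) (v : ℕ) :
    ∑ i, setx f 1 v i + f ⟨0, hn⟩ = ∑ i, f i + v := by
  obtain ⟨k, rfl⟩ : ∃ k, n = k + 1 := ⟨n - 1, by omega⟩
  rw [Fin.sum_univ_succ, Fin.sum_univ_succ]
  have : (⟨0, hn⟩ : Fin (k + 1)) = 0 := rfl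
  rw [this]
  simp [setx]
  omega

theorem tsum_eq_s11 {n : ℕ} (b : Tup n) : tsum b = ∑ i, b.1 i + ∑ i, b.2 i := by
  simp [tsum, Finset.sum_add_distrib]

theorem phi_zero (n l : ℕ) (hn : 2 ≤ n) (b : Tup n) (hb : memC n l b) :
    phiC n l 0 b = (l - tsum b) / 2 + (xbc b 1 - xc b 1) := by
  have hn0 : 0 < n := by omega
  refine iter_sSup (fC n l 0) (memC n l) (fun b => (l - tsum b) / 2 + (xbc b 1 - xc b 1))
    ?_ ?_ b hb
  · intro b hb h
    simp only [fC, memC, hn0, if_true] at h hb ⊢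
    split_ifs at h
    omega
  · intro b hb c h
    have hA := sum_setx hn0 b.1
    have hB := sum_setx hn0 b.2
    have hx : xc b 1 = b.1 ⟨0, hn0⟩ := by simp [xc, hn0]
    have hy : xbc b 1 = b.2 ⟨0, hn0⟩ := by simp [xbc, hn0]
    simp only [fC, memC, hn0, if_true, tsum_eq_s11] at h hb ⊢
    split_ifs at h with h1 h2 h2 <;> obtain rfl := Option.some.inj h
    · have := hA (xc b 1 + 2)
      have e1 : xc (setx b.1 1 (xc b 1 + 2), b.2) 1 = xc b 1 + 2 := by simp [xc, hn0, setx]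
      have e2 : xbc (setx b.1 1 (xc b 1 + 2), b.2) 1 = xbc b 1 := by simp [xbc]
      simp only [e1, e2]
      omega
    · have := hA (xc b 1 + 1)
      have := hB (xbc b 1 - 1)
      have e1 : xc (setx b.1 1 (xc b 1 + 1), setx b.2 1 (xbc b 1 - 1)) 1 = xc b 1 + 1 := by
        simp [xc, hn0, setx]
      have e2 : xbc (setx b.1 1 (xc b 1 + 1), setx b.2 1 (xbc b 1 - 1)) 1 = xbc b 1 - 1 := by
        simp [xbc, hn0, setx]
      simp only [e1, e2]
      omega
    · have := hB (xbc b 1 - 2)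
      have e1 : xc (b.1, setx b.2 1 (xbc b 1 - 2)) 1 = xc b 1 := by simp [xc]
      have e2 : xbc (b.1, setx b.2 1 (xbc b 1 - 2)) 1 = xbc b 1 - 2 := by simp [xbc, hn0, setx]
      simp only [e1, e2]
      omega

theorem eps_zero (n l : ℕ) (hn : 2 ≤ n) (b : Tup n) (hb : memC n l b) :
    epsC n l 0 b = (l - tsum b) / 2 + (xc b 1 - xbc b 1) := by
  have hn0 : 0 < n := by omega
  refine iter_sSup (eC n l 0) (memC n l) (fun b => (l - tsum b) / 2 + (xc b 1 - xbc b 1))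
    ?_ ?_ b hb
  · intro b hb h
    simp only [eC, memC, hn0, if_true] at h hb ⊢
    split_ifs at h
    omega
  · intro b hb c h
    have hA := sum_setx hn0 b.1
    have hB := sum_setx hn0 b.2
    have hx : xc b 1 = b.1 ⟨0, hn0⟩ := by simp [xc, hn0]
    have hy : xbc b 1 = b.2 ⟨0, hn0⟩ := by simp [xbc, hn0]
    simp only [eC, memC, hn0, if_true, tsum_eq_s11] at h hb ⊢
    split_ifs at h with h1 h2 h3 <;> obtain rfl := Option.some.inj h
    · have := hA (xc b 1 - 2)
      have e1 : xc (setx b.1 1 (xc b 1 - 2), b.2) 1 = xc b 1 - 2 := by simp [xc, hn0, setx]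
      have e2 : xbc (setx b.1 1 (xc b 1 - 2), b.2) 1 = xbc b 1 := by simp [xbc]
      simp only [e1, e2]
      omega
    · have := hA (xc b 1 - 1)
      have := hB (xbc b 1 + 1)
      have e1 : xc (setx b.1 1 (xc b 1 - 1), setx b.2 1 (xbc b 1 + 1)) 1 = xc b 1 - 1 := by
        simp [xc, hn0, setx]
      have e2 : xbc (setx b.1 1 (xc b 1 - 1), setx b.2 1 (xbc b 1 + 1)) 1 = xbc b 1 + 1 := by
        simp [xbc, hn0, setx]
      simp only [e1, e2]
      omega
    · have := hB (xbc b 1 + 2)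
      have e1 : xc (b.1, setx b.2 1 (xbc b 1 + 2)) 1 = xc b 1 := by simp [xc]
      have e2 : xbc (b.1, setx b.2 1 (xbc b 1 + 2)) 1 = xbc b 1 + 2 := by simp [xbc, hn0, setx]
      simp only [e1, e2]
      omega

/-- **Compatibility of `τ^l_{l-2}` with the crystal operators.**  The map `τ^l_{l-2}` is the
identity on underlying tuples, regarded as a map `B_{l-2} → B_l`.  For `b ∈ B_{l-2}` and
`0 ≤ i ≤ n`: `f̃_i` and `ẽ_i` commute with `τ^l_{l-2}` whenever they do not vanish, and
`φ_i`, `ε_i` increase exactly by `δ_{i,0}`. -/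
theorem tau_compatibility
    (n l : ℕ) (hn : 2 ≤ n) (hl : 3 ≤ l)
    (b : Tup n) (hb : b ∈ BC n (l - 2)) (i : ℕ) (hi : i ≤ n) :
    (fC n (l - 2) i b ≠ none → fC n l i b = fC n (l - 2) i b) ∧
    (eC n (l - 2) i b ≠ none → eC n l i b = eC n (l - 2) i b) ∧
    phiC n l i b = phiC n (l - 2) i b + (if i = 0 then 1 else 0) ∧
    epsC n l i b = epsC n (l - 2) i b + (if i = 0 then 1 else 0) := by
  have hb' : memC n (l - 2) b := hb
  have hbl : memC n l b := by
    simp only [memC] at hb' ⊢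
    omega
  by_cases h : i = 0
  · subst h
    have hn0 : 0 < n := by omega
    refine ⟨?_, ?_, ?_, ?_⟩
    · simp only [fC, hn0, if_true]
      intro h
      split_ifs at h ⊢ <;> first | rfl | omega | exact absurd rfl h
    · simp only [eC, hn0, if_true]
      intro h
      split_ifs at h ⊢ <;> first | rfl | omega | exact absurd rfl h
    · rw [phi_zero n l hn b hbl, phi_zero n (l - 2) hn b hb']
      simp only [memC, if_true] at *
      omega
    · rw [eps_zero n l hn b hbl, eps_zero n (l - 2) hn b hb']
      simp only [memC, if_true] at *
      omega
  · have hf : fC n l i = fC n (l - 2) i := by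
      funext c; simp only [fC, h, if_false]
    have he : eC n l i = eC n (l - 2) i := by
      funext c; simp only [eC, h, if_false]
    refine ⟨fun _ => by rw [hf], fun _ => by rw [he], ?_, ?_⟩
    · simp only [phiC, fCIter, hf, h, if_false, add_zero]
    · simp only [epsC, eCIter, he, h, if_false, add_zero]

end KTT
end
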